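/- arXiv:2503.12176 — 2 statements merged into one kernel-verified Lean document; each statement's English description precedes it below -/
import Mathlib

section
/- (Theorem 4.1) Let the sequences (xᵏ, yᵏ, uᵏ, θ_k) be generated by the FPSA iteration, assume ri(S) ∩ ri(dom g) ≠ ∅ (or S polyhedral and S ∩ ri(dom g) ≠ ∅), and suppose f* is calm at yᵏ for all sufficiently large k. Then there exist ζ > 0 and an index K₀ such that for all k ≥ K₀, dist(0, ∂ϖ(xᵏ⁺¹, yᵏ⁺¹, uᵏ⁺¹)) ≤ ζ(‖xᵏ − xᵏ⁺¹‖ + ‖uᵏ − uᵏ⁺¹‖), where ∂ϖ denotes the limiting subdifferential of the merit function ϖ(x,y,u) = φ(x,u)/(⟨Kx, y⟩ − f*(y)). -/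
open Filter Metric Set RealInnerProductSpace
open scoped Topology Classical

noncomputable section

/-- Convexity for extended-real-valued functions. -/
def ERealConvex {α : Type*} [AddCommGroup α] [Module ℝ α] (f : α → EReal) : Prop :=
  ∀ x y : α, ∀ a b : ℝ, 0 ≤ a → 0 ≤ b → a + b = 1 →
    f (a • x + b • y) ≤ (a : EReal) * f x + (b : EReal) * f y

/-- A proper extended-real-valued function: never `⊥` and finite somewhere. -/
def ERealProper {α : Type*} (f : α → EReal) : Prop :=
  (∀ x, f x ≠ ⊥) ∧ ∃ x, f x ≠ ⊤

/-- Effective domain of an extended-real-valued function. -/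
def edom {α : Type*} (f : α → EReal) : Set α := {x | f x ≠ ⊤}

/-- Convex (Fenchel) conjugate. -/
def econj {α : Type*} [NormedAddCommGroup α] [InnerProductSpace ℝ α]
    (f : α → EReal) (y : α) : EReal :=
  ⨆ z, (((⟪z, y⟫ : ℝ) : EReal) - f z)

/-- Convex subdifferential. -/
def csubdiff {α : Type*} [NormedAddCommGroup α] [InnerProductSpace ℝ α]
    (f : α → EReal) (z : α) : Set α :=
  {v | ∀ w, f z + ((⟪v, w - z⟫ : ℝ) : EReal) ≤ f w}

/-- Normal cone of a convex set. -/
def normalCone {α : Type*} [NormedAddCommGroup α] [InnerProductSpace ℝ α]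
    (S : Set α) (x : α) : Set α :=
  {v | ∀ z ∈ S, ⟪v, z - x⟫ ≤ 0}

/-- Calmness of an extended-real-valued function at a point of its domain. -/
def ECalm {α : Type*} [NormedAddCommGroup α] (f : α → EReal) (y : α) : Prop :=
  f y ≠ ⊤ ∧ ∃ ϱ > (0:ℝ), ∃ ε > (0:ℝ), ∀ y' ∈ Metric.ball y ε,
    f y - ((ϱ * ‖y' - y‖ : ℝ) : EReal) ≤ f y' ∧ f y' ≤ f y + ((ϱ * ‖y' - y‖ : ℝ) : EReal)

/-- Fréchet subdifferential of an extended-real-valued function of one variable. -/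
def fsub {α : Type*} [NormedAddCommGroup α] [InnerProductSpace ℝ α]
    (f : α → EReal) (x : α) : Set α :=
  {v | 0 ≤ Filter.liminf
      (fun z => (f z - f x - ((⟪v, z - x⟫ : ℝ) : EReal)) * (((‖z - x‖)⁻¹ : ℝ) : EReal))
      (𝓝[≠] x)}

/-- Fréchet subdifferential of a function of two (inner-product-space) variables. -/
def fsub2 {α β : Type*} [NormedAddCommGroup α] [InnerProductSpace ℝ α]
    [NormedAddCommGroup β] [InnerProductSpace ℝ β]
    (Φ : α → β → EReal) (a : α) (b : β) : Set (α × β) :=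
  {v | 0 ≤ Filter.liminf
      (fun w : α × β =>
        (Φ w.1 w.2 - Φ a b - ((⟪v.1, w.1 - a⟫ + ⟪v.2, w.2 - b⟫ : ℝ) : EReal)) *
          (((‖w - (a, b)‖)⁻¹ : ℝ) : EReal))
      (𝓝[≠] (a, b))}

/-- Limiting (Mordukhovich) subdifferential of a function of two variables. -/
def lsub2 {α β : Type*} [NormedAddCommGroup α] [InnerProductSpace ℝ α]
    [NormedAddCommGroup β] [InnerProductSpace ℝ β]
    (Φ : α → β → EReal) (a : α) (b : β) : Set (α × β) :=
  {v | ∃ w : ℕ → α × β, ∃ vs : ℕ → α × β,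
      Tendsto w atTop (𝓝 (a, b)) ∧
      Tendsto (fun k => Φ (w k).1 (w k).2) atTop (𝓝 (Φ a b)) ∧
      (∀ k, vs k ∈ fsub2 Φ (w k).1 (w k).2) ∧
      Tendsto vs atTop (𝓝 v)}

/-- Fréchet subdifferential of a function of three variables. -/
def fsub3 {α β γ : Type*} [NormedAddCommGroup α] [InnerProductSpace ℝ α]
    [NormedAddCommGroup β] [InnerProductSpace ℝ β]
    [NormedAddCommGroup γ] [InnerProductSpace ℝ γ]
    (Φ : α → β → γ → EReal) (a : α) (b : β) (c : γ) : Set (α × β × γ) :=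
  {v | 0 ≤ Filter.liminf
      (fun w : α × β × γ =>
        (Φ w.1 w.2.1 w.2.2 - Φ a b c -
          ((⟪v.1, w.1 - a⟫ + ⟪v.2.1, w.2.1 - b⟫ + ⟪v.2.2, w.2.2 - c⟫ : ℝ) : EReal)) *
          (((‖w - (a, b, c)‖)⁻¹ : ℝ) : EReal))
      (𝓝[≠] (a, b, c))}

/-- Limiting (Mordukhovich) subdifferential of a function of three variables. -/
def lsub3 {α β γ : Type*} [NormedAddCommGroup α] [InnerProductSpace ℝ α]
    [NormedAddCommGroup β] [InnerProductSpace ℝ β]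
    [NormedAddCommGroup γ] [InnerProductSpace ℝ γ]
    (Φ : α → β → γ → EReal) (a : α) (b : β) (c : γ) : Set (α × β × γ) :=
  {v | ∃ w : ℕ → α × β × γ, ∃ vs : ℕ → α × β × γ,
      Tendsto w atTop (𝓝 (a, b, c)) ∧
      Tendsto (fun k => Φ (w k).1 (w k).2.1 (w k).2.2) atTop (𝓝 (Φ a b c)) ∧
      (∀ k, vs k ∈ fsub3 Φ (w k).1 (w k).2.1 (w k).2.2) ∧
      Tendsto vs atTop (𝓝 v)}

/-- A polyhedral set: a finite intersection of closed half-spaces. -/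
def IsPolyhedral {α : Type*} [NormedAddCommGroup α] [InnerProductSpace ℝ α]
    (S : Set α) : Prop :=
  ∃ (m : ℕ) (a : Fin m → α) (b : Fin m → ℝ), S = {z | ∀ i, ⟪a i, z⟫ ≤ b i}

/-- The merit function φ(x,u) = g(x) + h(x) + ι_S(x) + (1/(2δ))‖x-u‖². -/
def phiF {n : ℕ} (S : Set (EuclideanSpace ℝ (Fin n)))
    (g : EuclideanSpace ℝ (Fin n) → EReal) (h : EuclideanSpace ℝ (Fin n) → ℝ) (δ : ℝ)
    (x u : EuclideanSpace ℝ (Fin n)) : EReal :=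
  g x + ((h x : ℝ) : EReal) + (if x ∈ S then (0 : EReal) else ⊤)
    + (((2 * δ)⁻¹ * ‖x - u‖ ^ 2 : ℝ) : EReal)

/-- ϑ(x,u) = φ(x,u)/f(Kx). -/
def varthetaF {n p : ℕ} (S : Set (EuclideanSpace ℝ (Fin n)))
    (g : EuclideanSpace ℝ (Fin n) → EReal) (h : EuclideanSpace ℝ (Fin n) → ℝ)
    (f : EuclideanSpace ℝ (Fin p) → EReal)
    (K : EuclideanSpace ℝ (Fin n) →ₗ[ℝ] EuclideanSpace ℝ (Fin p)) (δ : ℝ)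
    (x u : EuclideanSpace ℝ (Fin n)) : EReal :=
  phiF S g h δ x u / f (K x)

/-- ϖ(x,y,u) = φ(x,u)/(⟨Kx,y⟩ - f*(y)). -/
def varpiF {n p : ℕ} (S : Set (EuclideanSpace ℝ (Fin n)))
    (g : EuclideanSpace ℝ (Fin n) → EReal) (h : EuclideanSpace ℝ (Fin n) → ℝ)
    (f : EuclideanSpace ℝ (Fin p) → EReal)
    (K : EuclideanSpace ℝ (Fin n) →ₗ[ℝ] EuclideanSpace ℝ (Fin p)) (δ : ℝ)
    (x : EuclideanSpace ℝ (Fin n)) (y : EuclideanSpace ℝ (Fin p))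
    (u : EuclideanSpace ℝ (Fin n)) : EReal :=
  phiF S g h δ x u / (((⟪K x, y⟫ : ℝ) : EReal) - econj f y)

lemma mem_fsub3_of_eventually {α β γ : Type*} [NormedAddCommGroup α] [InnerProductSpace ℝ α]
    [NormedAddCommGroup β] [InnerProductSpace ℝ β]
    [NormedAddCommGroup γ] [InnerProductSpace ℝ γ]
    {Φ : α → β → γ → EReal} {a : α} {b : β} {c : γ} {v : α × β × γ} {r : ℝ}
    (hr : Φ a b c = (r : EReal))
    (hev : ∀ ε > (0:ℝ), ∀ᶠ w in 𝓝 (a, b, c),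
      ((r + (⟪v.1, w.1 - a⟫ + ⟪v.2.1, w.2.1 - b⟫ + ⟪v.2.2, w.2.2 - c⟫)
        - ε * ‖w - (a, b, c)‖ : ℝ) : EReal) ≤ Φ w.1 w.2.1 w.2.2) :
    v ∈ fsub3 Φ a b c := by
  have key : ∀ ε > (0:ℝ), ((-ε : ℝ) : EReal) ≤ Filter.liminf
      (fun w : α × β × γ =>
        (Φ w.1 w.2.1 w.2.2 - Φ a b c -
          ((⟪v.1, w.1 - a⟫ + ⟪v.2.1, w.2.1 - b⟫ + ⟪v.2.2, w.2.2 - c⟫ : ℝ) : EReal)) *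
          (((‖w - (a, b, c)‖)⁻¹ : ℝ) : EReal))
      (𝓝[≠] (a, b, c)) := by
    intro ε hε
    apply le_liminf_of_le
    · isBoundedDefault
    have h1 := (hev ε hε).filter_mono (nhdsWithin_le_nhds (s := {(a, b, c)}ᶜ))
    filter_upwards [h1, self_mem_nhdsWithin] with w hw hne
    have hpos : 0 < ‖w - (a, b, c)‖ := norm_pos_iff.mpr (sub_ne_zero.mpr hne)
    rw [hr]
    induction hΦ : Φ w.1 w.2.1 w.2.2 with
    | bot => rw [hΦ] at hw; exact absurd (le_bot_iff.mp hw) (EReal.coe_ne_bot _)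
    | top =>
      have : ((⊤ : EReal) - (r : EReal) -
          ((⟪v.1, w.1 - a⟫ + ⟪v.2.1, w.2.1 - b⟫ + ⟪v.2.2, w.2.2 - c⟫ : ℝ) : EReal)) = ⊤ := by
        rw [EReal.top_sub_coe, EReal.top_sub_coe]
      rw [this, EReal.top_mul_coe_of_pos (inv_pos.mpr hpos)]
      exact le_top
    | coe t =>
      rw [hΦ] at hw
      have hw' := EReal.coe_le_coe_iff.mp hw
      rw [← EReal.coe_sub, ← EReal.coe_sub, ← EReal.coe_mul, EReal.coe_le_coe_iff,
        ← div_eq_mul_inv, le_div_iff₀ hpos]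
      linarith
  refine (le_of_forall_lt fun t ht => ?_ : (0 : EReal) ≤ _)
  obtain ⟨q, hq1, hq2⟩ := EReal.lt_iff_exists_real_btwn.mp ht
  have hq : q < 0 := by exact_mod_cast hq2
  refine hq1.trans_le ?_
  simpa using key (-q) (by linarith)

lemma infDist_lsub3_le_norm {α β γ : Type*} [NormedAddCommGroup α] [InnerProductSpace ℝ α]
    [NormedAddCommGroup β] [InnerProductSpace ℝ β]
    [NormedAddCommGroup γ] [InnerProductSpace ℝ γ]
    {Φ : α → β → γ → EReal} {a : α} {b : β} {c : γ} {v : α × β × γ}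
    (hv : v ∈ fsub3 Φ a b c) :
    Metric.infDist (0 : α × β × γ) (lsub3 Φ a b c) ≤ ‖v‖ := by
  have hmem : v ∈ lsub3 Φ a b c :=
    ⟨fun _ => (a, b, c), fun _ => v, tendsto_const_nhds, tendsto_const_nhds, fun _ => hv,
      tendsto_const_nhds⟩
  simpa using Metric.infDist_le_dist_of_mem (x := (0 : α × β × γ)) hmem

lemma le_of_forall_small_mul {A B : ℝ}
    (hAB : ∀ t : ℝ, 0 < t → t ≤ 1 → A ≤ t * B) : A ≤ 0 := by
  by_contra! hA
  have h1 := hAB 1 one_pos le_rfl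
  have hB : 0 < B := by linarith
  have h2 := hAB (A / (2 * B)) (by positivity) (by rw [div_le_one (by positivity)]; linarith)
  have : A / (2 * B) * B = A / 2 := by field_simp
  linarith

lemma subgradient_of_prox {E : Type*} [NormedAddCommGroup E] [InnerProductSpace ℝ E]
    {S : Set E} (hS : Convex ℝ S) {g : E → EReal} (hbot : ∀ z, g z ≠ ⊥) (hg : ERealConvex g)
    {δ : ℝ} (hδ : 0 < δ) {c z : E} (hz : z ∈ S) (hgz : g z ≠ ⊤)
    (hmin : ∀ w ∈ S, g z + (((2*δ)⁻¹ * ‖z - c‖ ^ 2 : ℝ) : EReal)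
      ≤ g w + (((2*δ)⁻¹ * ‖w - c‖ ^ 2 : ℝ) : EReal))
    {w : E} (hw : w ∈ S) (hgw : g w ≠ ⊤) :
    (g z).toReal + ⟪δ⁻¹ • (c - z), w - z⟫ ≤ (g w).toReal := by
  have ez := EReal.coe_toReal hgz (hbot z)
  have ew := EReal.coe_toReal hgw (hbot w)
  set a := (g z).toReal
  set b := (g w).toReal
  suffices a + ⟪δ⁻¹ • (c - z), w - z⟫ - b ≤ 0 by linarith
  refine le_of_forall_small_mul (B := (2*δ)⁻¹ * ‖w - z‖ ^ 2) fun t ht ht1 => ?_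
  have h1 := hmin _ (hS hz hw (sub_nonneg.mpr ht1) ht.le (by ring))
  have h2 := hg z w (1 - t) t (sub_nonneg.mpr ht1) ht.le (by ring)
  have h3 := h1.trans (add_le_add_left h2 _)
  rw [← ez, ← ew] at h3
  have h4 : a + (2*δ)⁻¹ * ‖z - c‖ ^ 2 ≤ (1 - t) * a + t * b +
      (2*δ)⁻¹ * ‖(1 - t) • z + t • w - c‖ ^ 2 := by exact_mod_cast h3
  have h5 : (1 - t) • z + t • w - c = (z - c) + t • (w - z) := by module
  rw [h5, norm_add_sq_real, inner_smul_right, norm_smul, mul_pow, Real.norm_eq_abs, sq_abs] at h4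
  have h6 : ⟪δ⁻¹ • (c - z), w - z⟫ = - (δ⁻¹ * ⟪z - c, w - z⟫) := by
    rw [inner_smul_left, ← neg_sub z c, inner_neg_left]; simp
  rw [h6]
  have h7 : (2*δ)⁻¹ = δ⁻¹ / 2 := by field_simp
  rw [h7] at h4 ⊢
  refine le_of_mul_le_mul_left ?_ ht
  nlinarith

lemma le_quadratic_of_lipschitz_gradient {E : Type*} [NormedAddCommGroup E]
    [InnerProductSpace ℝ E] [CompleteSpace E] {S : Set E} (hS : Convex ℝ S)
    {h : E → ℝ} {gh : E → E} {L : ℝ} (hgrad : ∀ z ∈ S, HasGradientAt h (gh z) z)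
    (hlip : ∀ z ∈ S, ∀ w ∈ S, ‖gh z - gh w‖ ≤ L * ‖z - w‖) {a b : E} (ha : a ∈ S) (hb : b ∈ S) :
    h b ≤ h a + ⟪gh a, b - a⟫ + L / 2 * ‖b - a‖ ^ 2 := by
  set d := b - a with hd
  have hseg : ∀ t ∈ Icc (0:ℝ) 1, a + t • d ∈ S := fun t ht => by
    simpa [hd, AffineMap.lineMap_apply, add_comm] using
      hS.add_smul_sub_mem ha hb ht
  let ψ : ℝ → ℝ := fun t => h (a + t • d) - t * ⟪gh a, d⟫ - L / 2 * t ^ 2 * ‖d‖ ^ 2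
  have hder : ∀ t ∈ Icc (0:ℝ) 1,
      HasDerivAt ψ (⟪gh (a + t • d), d⟫ - ⟪gh a, d⟫ - L * t * ‖d‖ ^ 2) t := by
    intro t ht
    have h1 : HasDerivAt (fun t : ℝ => a + t • d) d t := by
      simpa using ((hasDerivAt_id t).smul_const d).const_add a
    have h2 := (hgrad _ (hseg t ht)).hasFDerivAt.comp_hasDerivAt t h1
    have h3 := (h2.sub ((hasDerivAt_id t).mul_const ⟪gh a, d⟫)).sub
      ((((hasDerivAt_id t).pow 2).const_mul (L / 2)).mul_const (‖d‖ ^ 2))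
    refine h3.congr_deriv ?_
    simp only [InnerProductSpace.toDual_apply_apply, id_eq]
    push_cast
    ring
  have hanti : AntitoneOn ψ (Icc 0 1) := by
    refine antitoneOn_of_hasDerivWithinAt_nonpos (convex_Icc 0 1)
      (fun t ht => (hder t ht).continuousAt.continuousWithinAt)
      (fun t ht => (hder t (interior_subset ht)).hasDerivWithinAt) fun t ht => ?_
    have ht' := interior_subset ht
    have h1 : ‖gh (a + t • d) - gh a‖ ≤ L * (t * ‖d‖) := by
      simpa [norm_smul, abs_of_nonneg ht'.1] using hlip _ (hseg t ht') a ha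
    have h2 := real_inner_le_norm (gh (a + t • d) - gh a) d
    rw [inner_sub_left] at h2
    nlinarith [mul_le_mul_of_nonneg_right h1 (norm_nonneg d)]
  have h01 := hanti (left_mem_Icc.mpr zero_le_one) (right_mem_Icc.mpr zero_le_one) zero_le_one
  simp only [ψ, one_smul, zero_smul, add_zero] at h01
  have : a + d = b := by simp [hd]
  rw [this] at h01
  linarith

lemma exists_bound_csubdiff {F : Type*} [NormedAddCommGroup F] [InnerProductSpace ℝ F]
    [FiniteDimensional ℝ F] {f : F → EReal} (hbot : ∀ z, f z ≠ ⊥) (hf : ERealConvex f)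
    {C : Set F} (hC : IsCompact C) (hCf : C ⊆ interior (edom f))
    (hpos : ∀ z ∈ C, (0 : EReal) < f z) :
    ∃ B : ℝ, 0 ≤ B ∧ ∀ z ∈ C, ∀ v ∈ csubdiff f z, ‖v‖ ≤ B := by
  have hco : ∀ z ∈ edom f, ((f z).toReal : EReal) = f z :=
    fun z hz => EReal.coe_toReal hz (hbot z)
  have hle : ∀ ⦃z⦄, z ∈ edom f → ∀ ⦃w⦄, w ∈ edom f → ∀ ⦃a b : ℝ⦄, 0 ≤ a → 0 ≤ b → a + b = 1 →
      f (a • z + b • w) ≤ ((a * (f z).toReal + b * (f w).toReal : ℝ) : EReal) := by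
    intro z hz w hw a b ha hb hab
    have := hf z w a b ha hb hab
    rw [← hco z hz, ← hco w hw] at this
    exact_mod_cast this
  have hdom : Convex ℝ (edom f) := fun z hz w hw a b ha hb hab =>
    ((hle hz hw ha hb hab).trans_lt (EReal.coe_lt_top _)).ne
  have hconv : ConvexOn ℝ (edom f) fun z => (f z).toReal := by
    refine ⟨hdom, fun z hz w hw a b ha hb hab => ?_⟩
    have := hle hz hw ha hb hab
    rw [← hco _ (hdom hz hw ha hb hab)] at this
    exact_mod_cast this
  obtain ⟨ε, hε, hsub⟩ := hC.exists_cthickening_subset_open isOpen_interior hCf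
  obtain ⟨B, hB⟩ := (hC.cthickening (r := ε)).bddAbove_image
    (hconv.continuousOn_interior.mono hsub)
  refine ⟨max B 0 / ε, by positivity, fun z hz v hv => ?_⟩
  rcases eq_or_ne v 0 with rfl | hv0
  · simp; positivity
  have hnv : 0 < ‖v‖ := norm_pos_iff.mpr hv0
  set w := z + (ε / ‖v‖) • v with hw
  have hwC : w ∈ Metric.cthickening ε C := by
    refine Metric.mem_cthickening_of_dist_le w z ε C hz ?_
    rw [hw, dist_eq_norm, add_sub_cancel_left, norm_smul, Real.norm_of_nonneg (by positivity),
      div_mul_cancel₀ _ hnv.ne']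
  have h1 := hv w
  have hz' : z ∈ edom f := interior_subset (hCf hz)
  have h2 : ⟪v, w - z⟫ = ε * ‖v‖ := by
    rw [hw, add_sub_cancel_left, inner_smul_right, real_inner_self_eq_norm_sq]
    field_simp
  have hz0 := hpos z hz
  rw [← hco z hz', ← hco w (interior_subset (hsub hwC)), h2] at h1
  rw [← hco z hz'] at hz0
  have h3 : (f z).toReal + ε * ‖v‖ ≤ (f w).toReal := by exact_mod_cast h1
  have h4 : 0 < (f z).toReal := by exact_mod_cast hz0
  have h5 : (f w).toReal ≤ B := hB ⟨w, hwC, rfl⟩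
  rw [le_div_iff₀ hε]
  linarith [le_max_left B 0]

lemma econj_eq_of_mem_csubdiff {F : Type*} [NormedAddCommGroup F] [InnerProductSpace ℝ F]
    {f : F → EReal} {z y : F} {r : ℝ} (hr : f z = (r : EReal)) (hy : y ∈ csubdiff f z) :
    econj f y = ((⟪z, y⟫ - r : ℝ) : EReal) := by
  apply le_antisymm
  · refine iSup_le fun w => ?_
    have h1 := hy w
    rw [hr] at h1
    induction hw : f w with
    | bot => rw [hw, ← EReal.coe_add] at h1; simp at h1
    | top => simp
    | coe t =>
      rw [hw] at h1
      have h2 : r + ⟪y, w - z⟫ ≤ t := by exact_mod_cast h1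
      rw [← EReal.coe_sub, EReal.coe_le_coe_iff]
      rw [inner_sub_right, real_inner_comm w y, real_inner_comm z y] at h2
      linarith
  · have := le_iSup (fun w => (((⟪w, y⟫ : ℝ) : EReal) - f w)) z
    simp only [hr] at this
    rwa [EReal.coe_sub]

lemma econj_locally_real {F : Type*} [NormedAddCommGroup F] [InnerProductSpace ℝ F]
    {f : F → EReal} {z y : F} {r : ℝ} (hr : f z = (r : EReal)) (hy : y ∈ csubdiff f z)
    (hcalm : ECalm (econj f) y) :
    ∃ e : F → ℝ, (∀ᶠ y' in 𝓝 y, econj f y' = (e y' : EReal)) ∧ ContinuousAt e y ∧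
      e y = ⟪z, y⟫ - r ∧ ∀ᶠ y' in 𝓝 y, e y + ⟪z, y' - y⟫ ≤ e y' := by
  obtain ⟨-, ϱ, hϱ, ε, hε, hc⟩ := hcalm
  have hey := econj_eq_of_mem_csubdiff hr hy
  set q := ⟪z, y⟫ - r with hq
  rw [hey] at hc
  have hreal : ∀ y' ∈ Metric.ball y ε, econj f y' = ((econj f y').toReal : EReal) := by
    intro y' hy'
    obtain ⟨h1, h2⟩ := hc y' hy'
    refine (EReal.coe_toReal ?_ ?_).symm
    · exact (h2.trans_lt (by rw [← EReal.coe_add]; exact EReal.coe_lt_top _)).ne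
    · exact ((by rw [← EReal.coe_sub]; exact EReal.bot_lt_coe _ : (⊥ : EReal) < _).trans_le h1).ne'
  have hball := Metric.ball_mem_nhds y hε
  have heq : (econj f y).toReal = q := by rw [hey, EReal.toReal_coe]
  refine ⟨fun y' => (econj f y').toReal, ?_, ?_, heq, ?_⟩
  · filter_upwards [hball] with y' hy' using hreal y' hy'
  · have hlim : Tendsto (fun y' => ϱ * ‖y' - y‖) (𝓝 y) (𝓝 0) := by
      have : ContinuousAt (fun y' => ϱ * ‖y' - y‖) y := by fun_prop
      simpa [ContinuousAt] using this
    rw [ContinuousAt, tendsto_iff_norm_sub_tendsto_zero]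
    refine squeeze_zero' (Eventually.of_forall fun _ => norm_nonneg _) ?_ hlim
    filter_upwards [hball] with y' hy'
    have h1 := hc y' hy'
    rw [hreal y' hy'] at h1
    have h2 : q - ϱ * ‖y' - y‖ ≤ (econj f y').toReal ∧
      (econj f y').toReal ≤ q + ϱ * ‖y' - y‖ := by exact_mod_cast h1
    simp only [heq, Real.norm_eq_abs, abs_le]
    constructor <;> linarith
  · filter_upwards [hball] with y' hy'
    have h1 := le_iSup (fun w => (((⟪w, y'⟫ : ℝ) : EReal) - f w)) z
    have h2 : (((⟪z, y'⟫ : ℝ) : EReal) - f z) ≤ ((econj f y').toReal : EReal) := by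
      rw [← hreal y' hy']; exact h1
    rw [hr] at h2
    have h3 : ⟪z, y'⟫ - r ≤ (econj f y').toReal := by exact_mod_cast h2
    simp only [heq, hq, inner_sub_right]
    linarith

lemma quotient_lower_bound {P Pw D Dw ℓ r ε ε₁ C η : ℝ} (hD : 0 < D) (hDw : D / 2 ≤ Dw)
    (hr : 0 ≤ r) (hε : 0 ≤ ε) (hN : ℓ - ε₁ * r ≤ D * (Pw - P) + P * (D - Dw))
    (hℓ : |ℓ| ≤ C * r) (hη : |Dw - D| ≤ η) (hε₁ : ε₁ ≤ ε * D ^ 2 / 4)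
    (hCη : C * η ≤ ε * D ^ 3 / 4) :
    P / D + ℓ / D ^ 2 - ε * r ≤ Pw / Dw := by
  have hDw0 : 0 < Dw := by linarith
  have h1 : ℓ * (Dw - D) ≤ ε * D ^ 3 / 4 * r := by
    calc ℓ * (Dw - D) ≤ |ℓ| * |Dw - D| := by rw [← abs_mul]; exact le_abs_self _
      _ ≤ (C * r) * η := mul_le_mul hℓ hη (abs_nonneg _) ((abs_nonneg _).trans hℓ)
      _ = (C * η) * r := by ring
      _ ≤ _ := mul_le_mul_of_nonneg_right hCη hr
  have h2 : (ℓ / D ^ 2 - ε * r) * (Dw * D) ≤ ℓ - ε₁ * r := by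
    have e : (ℓ / D ^ 2 - ε * r) * (Dw * D) = ℓ + ℓ * (Dw - D) / D - ε * r * (Dw * D) := by
      field_simp; ring
    have h3 : ℓ * (Dw - D) / D ≤ ε * D ^ 2 / 4 * r := by
      rw [div_le_iff₀ hD]; linarith
    have h4 : ε * r * (D / 2 * D) ≤ ε * r * (Dw * D) := by gcongr
    have h5 := mul_le_mul_of_nonneg_right hε₁ hr
    rw [e]; nlinarith
  have h3 : Pw / Dw - P / D = (D * (Pw - P) + P * (D - Dw)) / (Dw * D) := by
    field_simp; ring
  have h4 : ℓ / D ^ 2 - ε * r ≤ (D * (Pw - P) + P * (D - Dw)) / (Dw * D) := by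
    rw [le_div_iff₀ (by positivity)]; exact h2.trans hN
  linarith

lemma sq_norm_sub_lower_bound {E : Type*} [NormedAddCommGroup E] [InnerProductSpace ℝ E]
    (a b : E) : ‖a‖ ^ 2 + 2 * ⟪a, b - a⟫ ≤ ‖b‖ ^ 2 := by
  have h1 := norm_add_sq_real a (b - a)
  rw [add_sub_cancel] at h1
  nlinarith [sq_nonneg ‖b - a‖]

lemma phiF_eq_coe {n : ℕ} {S : Set (EuclideanSpace ℝ (Fin n))}
    {g : EuclideanSpace ℝ (Fin n) → EReal} {h : EuclideanSpace ℝ (Fin n) → ℝ} {δ : ℝ}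
    {x : EuclideanSpace ℝ (Fin n)} (u : EuclideanSpace ℝ (Fin n)) (hx : x ∈ S)
    (hg : g x ≠ ⊤) (hbot : g x ≠ ⊥) :
    phiF S g h δ x u = (((g x).toReal + h x + (2 * δ)⁻¹ * ‖x - u‖ ^ 2 : ℝ) : EReal) := by
  rw [phiF, if_pos hx, add_zero, EReal.coe_add, EReal.coe_add, EReal.coe_toReal hg hbot]

lemma phiF_eq_top {n : ℕ} {S : Set (EuclideanSpace ℝ (Fin n))}
    {g : EuclideanSpace ℝ (Fin n) → EReal} {h : EuclideanSpace ℝ (Fin n) → ℝ} {δ : ℝ}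
    {x : EuclideanSpace ℝ (Fin n)} (u : EuclideanSpace ℝ (Fin n))
    (hx : ¬ (x ∈ S ∧ g x ≠ ⊤)) (hbot : g x ≠ ⊥) : phiF S g h δ x u = ⊤ := by
  rw [phiF]
  have h1 : g x + ((h x : ℝ) : EReal) ≠ ⊥ := by simp [EReal.add_eq_bot_iff, hbot]
  by_cases hxS : x ∈ S
  · have hgx : g x = ⊤ := by by_contra hne; exact hx ⟨hxS, hne⟩
    rw [if_pos hxS, hgx, add_zero, EReal.top_add_coe, EReal.top_add_coe]
  · rw [if_neg hxS, EReal.add_top_of_ne_bot h1, EReal.top_add_coe]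

lemma mem_fsub3_varpiF {n p : ℕ} {S : Set (EuclideanSpace ℝ (Fin n))}
    {g : EuclideanSpace ℝ (Fin n) → EReal} {h : EuclideanSpace ℝ (Fin n) → ℝ}
    {f : EuclideanSpace ℝ (Fin p) → EReal}
    {K : EuclideanSpace ℝ (Fin n) →ₗ[ℝ] EuclideanSpace ℝ (Fin p)} {δ : ℝ} (hδ : 0 < δ)
    (hbot : ∀ z, g z ≠ ⊥) {x u gx ξ : EuclideanSpace ℝ (Fin n)}
    {y s : EuclideanSpace ℝ (Fin p)} (hx : x ∈ S) (hgx : g x ≠ ⊤)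
    (hgrad : HasGradientAt h gx x)
    (hξ : ∀ w ∈ S, g w ≠ ⊤ → (g x).toReal + ⟪ξ, w - x⟫ ≤ (g w).toReal)
    {e : EuclideanSpace ℝ (Fin p) → ℝ} (he : ∀ᶠ y' in 𝓝 y, econj f y' = (e y' : EReal))
    (hec : ContinuousAt e y) (hes : ∀ᶠ y' in 𝓝 y, e y + ⟪s, y' - y⟫ ≤ e y')
    {P D : ℝ} (hP : P = (g x).toReal + h x + (2 * δ)⁻¹ * ‖x - u‖ ^ 2) (hP0 : 0 ≤ P)
    (hD : D = ⟪K x, y⟫ - e y) (hD0 : 0 < D) :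
    (D⁻¹ • (ξ + gx + δ⁻¹ • (x - u)) - (P / D ^ 2) • LinearMap.adjoint K y,
      (P / D ^ 2) • (s - K x), (D⁻¹ * δ⁻¹) • (u - x)) ∈
      fsub3 (fun a b c => varpiF S g h f K δ a b c) x y u := by
  set v₁ := D⁻¹ • (ξ + gx + δ⁻¹ • (x - u)) - (P / D ^ 2) • LinearMap.adjoint K y with hv₁
  set v₂ := (P / D ^ 2) • (s - K x) with hv₂
  set v₃ := (D⁻¹ * δ⁻¹) • (u - x) with hv₃
  obtain ⟨κ, hκ0, hκ⟩ : ∃ κ, 0 ≤ κ ∧ ∀ z, ‖K z‖ ≤ κ * ‖z‖ :=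
    ⟨‖LinearMap.toContinuousLinearMap K‖, norm_nonneg _,
      fun z => (LinearMap.toContinuousLinearMap K).le_opNorm z⟩
  have hKc : Continuous K := K.continuous_of_finiteDimensional
  have hval : varpiF S g h f K δ x y u = ((P / D : ℝ) : EReal) := by
    rw [varpiF, phiF_eq_coe u hx hgx (hbot x), he.self_of_nhds, ← EReal.coe_sub, ← hP, ← hD,
      ← EReal.coe_div]
  refine mem_fsub3_of_eventually hval fun ε hε => ?_
  set C := D ^ 2 * (‖v₁‖ + ‖v₂‖ + ‖v₃‖) with hC
  have t₁ : Tendsto (fun w : EuclideanSpace ℝ (Fin n) × EuclideanSpace ℝ (Fin p) ×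
      EuclideanSpace ℝ (Fin n) => w.1) (𝓝 (x, y, u)) (𝓝 x) := continuous_fst.tendsto _
  have t₂ : Tendsto (fun w : EuclideanSpace ℝ (Fin n) × EuclideanSpace ℝ (Fin p) ×
      EuclideanSpace ℝ (Fin n) => w.2.1) (𝓝 (x, y, u)) (𝓝 y) :=
    (continuous_fst.comp continuous_snd).tendsto _
  have hDc : Tendsto (fun w : EuclideanSpace ℝ (Fin n) × EuclideanSpace ℝ (Fin p) ×
      EuclideanSpace ℝ (Fin n) => ⟪K w.1, w.2.1⟫ - e w.2.1) (𝓝 (x, y, u)) (𝓝 D) := by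
    rw [hD]
    exact (((hKc.tendsto x).comp t₁).inner t₂).sub (hec.tendsto.comp t₂)
  have hDη : ∀ᶠ w : EuclideanSpace ℝ (Fin n) × EuclideanSpace ℝ (Fin p) ×
      EuclideanSpace ℝ (Fin n) in 𝓝 (x, y, u),
      C * |⟪K w.1, w.2.1⟫ - e w.2.1 - D| < ε * D ^ 3 / 4 := by
    have : Tendsto (fun w : EuclideanSpace ℝ (Fin n) × EuclideanSpace ℝ (Fin p) ×
      EuclideanSpace ℝ (Fin n) => C * |⟪K w.1, w.2.1⟫ - e w.2.1 - D|) (𝓝 (x, y, u)) (𝓝 0) := by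
      simpa using ((hDc.sub_const D).abs).const_mul C
    exact this.eventually_lt_const (by positivity)
  have hrs : ∀ᶠ w : EuclideanSpace ℝ (Fin n) × EuclideanSpace ℝ (Fin p) ×
      EuclideanSpace ℝ (Fin n) in 𝓝 (x, y, u), P * κ * ‖w - (x, y, u)‖ < ε * D ^ 2 / 8 := by
    have hcont : Continuous fun w : EuclideanSpace ℝ (Fin n) × EuclideanSpace ℝ (Fin p) ×
      EuclideanSpace ℝ (Fin n) => P * κ * ‖w - (x, y, u)‖ := by fun_prop
    have := hcont.tendsto (x, y, u)
    rw [sub_self, norm_zero, mul_zero] at this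
    exact this.eventually_lt_const (by positivity)
  have hh : ∀ᶠ x' in 𝓝 x, ‖h x' - h x - ⟪gx, x' - x⟫‖ ≤ ε * D / 8 * ‖x' - x‖ := by
    simpa using hgrad.hasFDerivAt.isLittleO.def (by positivity : 0 < ε * D / 8)
  filter_upwards [hDη, hrs, t₁.eventually hh, t₂.eventually he, t₂.eventually hes,
    hDc.eventually_const_lt (half_lt_self hD0)] with w h1 h2 h3 h4 h5 h6
  obtain ⟨x', y', u'⟩ := w
  dsimp only at h1 h2 h3 h4 h5 h6 ⊢
  rw [varpiF, h4, ← EReal.coe_sub]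
  set Dw := ⟪K x', y'⟫ - e y' with hDw
  have hDw0 : 0 < Dw := by linarith
  by_cases hx' : x' ∈ S ∧ g x' ≠ ⊤
  swap
  · rw [phiF_eq_top u' hx' (hbot x'), EReal.top_div_of_pos_ne_top (by exact_mod_cast hDw0)
      (EReal.coe_ne_top _)]
    exact le_top
  rw [phiF_eq_coe u' hx'.1 hx'.2 (hbot x'), ← EReal.coe_div, EReal.coe_le_coe_iff]
  set Pw := (g x').toReal + h x' + (2 * δ)⁻¹ * ‖x' - u'‖ ^ 2 with hPw
  set r := ‖(x', y', u') - (x, y, u)‖ with hr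
  have hr0 : 0 ≤ r := norm_nonneg _
  have hrx : ‖x' - x‖ ≤ r := norm_fst_le ((x', y', u') - (x, y, u))
  have hr2 : ‖((x', y', u') - (x, y, u)).2‖ ≤ r := norm_snd_le _
  have hry : ‖y' - y‖ ≤ r := (norm_fst_le ((x', y', u') - (x, y, u)).2).trans hr2
  have hru : ‖u' - u‖ ≤ r := (norm_snd_le ((x', y', u') - (x, y, u)).2).trans hr2
  set ℓ := ⟪v₁, x' - x⟫ + ⟪v₂, y' - y⟫ + ⟪v₃, u' - u⟫ with hℓ
  have hℓabs : |D ^ 2 * ℓ| ≤ C * r := by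
    rw [abs_mul, abs_of_pos (by positivity : 0 < D ^ 2), hC, mul_assoc]
    refine mul_le_mul_of_nonneg_left ?_ (by positivity)
    have a₁ := (abs_real_inner_le_norm v₁ (x' - x)).trans
      (mul_le_mul_of_nonneg_left hrx (norm_nonneg v₁))
    have a₂ := (abs_real_inner_le_norm v₂ (y' - y)).trans
      (mul_le_mul_of_nonneg_left hry (norm_nonneg v₂))
    have a₃ := (abs_real_inner_le_norm v₃ (u' - u)).trans
      (mul_le_mul_of_nonneg_left hru (norm_nonneg v₃))
    have := abs_add_three ⟪v₁, x' - x⟫ ⟪v₂, y' - y⟫ ⟪v₃, u' - u⟫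
    linarith
  have hPdiff : ⟪ξ + gx + δ⁻¹ • (x - u), x' - x⟫ + ⟪δ⁻¹ • (u - x), u' - u⟫ - ε * D / 8 * r
      ≤ Pw - P := by
    have b₁ := hξ x' hx'.1 hx'.2
    have b₂ := (abs_le.mp h3).1
    have b₃ := mul_le_mul_of_nonneg_left hrx (by positivity : 0 ≤ ε * D / 8)
    have b₄ := mul_le_mul_of_nonneg_left (sq_norm_sub_lower_bound (x - u) (x' - u'))
      (by positivity : 0 ≤ (2 * δ)⁻¹)
    have e₁ : (2 * δ)⁻¹ * (‖x - u‖ ^ 2 + 2 * ⟪x - u, x' - u' - (x - u)⟫) =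
        (2 * δ)⁻¹ * ‖x - u‖ ^ 2 + δ⁻¹ * ⟪x - u, x' - u' - (x - u)⟫ := by
      field_simp
    have e₂ : x' - u' - (x - u) = (x' - x) - (u' - u) := by abel
    rw [e₁, e₂, inner_sub_right] at b₄
    rw [← neg_sub x u, smul_neg, inner_neg_left, inner_add_left, inner_add_left,
      real_inner_smul_left, real_inner_smul_left]
    rw [hPw, hP]
    linarith
  have hDdiff : ⟪s - K x, y' - y⟫ - ⟪LinearMap.adjoint K y, x' - x⟫ - κ * r * r ≤ D - Dw := by
    have b₁ : ⟪K (x' - x), y' - y⟫ ≤ κ * r * r := by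
      refine (real_inner_le_norm _ _).trans (mul_le_mul ?_ hry (norm_nonneg _) (by positivity))
      exact (hκ _).trans (mul_le_mul_of_nonneg_left hrx hκ0)
    rw [LinearMap.adjoint_inner_left, hD, hDw]
    rw [map_sub, inner_sub_left, inner_sub_right, inner_sub_right] at b₁
    rw [map_sub, inner_sub_left, inner_sub_right (K x), inner_sub_right y,
      real_inner_comm (K x') y, real_inner_comm (K x) y]
    linarith
  have hℓeq : D ^ 2 * ℓ = D * (⟪ξ + gx + δ⁻¹ • (x - u), x' - x⟫ + ⟪δ⁻¹ • (u - x), u' - u⟫) +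
      P * (⟪s - K x, y' - y⟫ - ⟪LinearMap.adjoint K y, x' - x⟫) := by
    rw [hℓ, hv₁, hv₂, hv₃, inner_sub_left, real_inner_smul_left, real_inner_smul_left,
      real_inner_smul_left, real_inner_smul_left, real_inner_smul_left]
    field_simp
    ring
  have hN : D ^ 2 * ℓ - (ε * D ^ 2 / 4) * r ≤ D * (Pw - P) + P * (D - Dw) := by
    have b₁ := mul_le_mul_of_nonneg_left hPdiff hD0.le
    have b₂ := mul_le_mul_of_nonneg_left hDdiff hP0
    have b₃ := mul_le_mul_of_nonneg_right h2.le hr0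
    rw [hℓeq]
    nlinarith
  have hfin := quotient_lower_bound hD0 h6.le hr0 hε.le hN hℓabs le_rfl le_rfl h1.le
  rwa [mul_div_cancel_left₀ _ (by positivity)] at hfin

lemma step_decrease {E F : Type*} [NormedAddCommGroup E] [InnerProductSpace ℝ E]
    [FiniteDimensional ℝ E] [NormedAddCommGroup F] [InnerProductSpace ℝ F]
    [FiniteDimensional ℝ F] {K : E →ₗ[ℝ] F} {x x' u u' v : E} {y : F}
    {G G' H H' Q Q' θ L δ σ : ℝ} (hδ : 0 < δ) (hσ : 0 < σ) (hσ2 : σ < 2) (hθ : 0 ≤ θ)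
    (hG : G' + ⟪δ⁻¹ • (u - x') - v + θ • LinearMap.adjoint K y, x - x'⟫ ≤ G)
    (hH : H' ≤ H + ⟪v, x' - x⟫ + L / 2 * ‖x' - x‖ ^ 2)
    (hQ : Q + ⟪y, K x' - K x⟫ ≤ Q') (hu : u' = (1 - σ) • u + σ • x')
    (hθQ : θ * Q = G + H + (2 * δ)⁻¹ * ‖x - u‖ ^ 2) :
    G' + H' + (2 * δ)⁻¹ * ‖x' - u'‖ ^ 2 + ((2 * δ)⁻¹ - L / 2) * ‖x' - x‖ ^ 2 ≤ θ * Q' := by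
  have h1 : ‖x - u‖ ^ 2 = ‖x' - u‖ ^ 2 - 2 * ⟪x' - u, x' - x⟫ + ‖x' - x‖ ^ 2 := by
    rw [← norm_sub_sq_real]; congr 2; abel
  have h2 : ‖x' - u'‖ ^ 2 ≤ ‖x' - u‖ ^ 2 := by
    have : x' - u' = (1 - σ) • (x' - u) := by rw [hu]; module
    rw [this, norm_smul, mul_pow, Real.norm_eq_abs, sq_abs]
    exact mul_le_of_le_one_left (sq_nonneg _) (by nlinarith)
  have h3 : ⟪δ⁻¹ • (u - x') - v + θ • LinearMap.adjoint K y, x - x'⟫ =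
      δ⁻¹ * ⟪x' - u, x' - x⟫ + ⟪v, x' - x⟫ - θ * ⟪y, K x' - K x⟫ := by
    rw [← neg_sub x' x, ← neg_sub x' u, inner_neg_right, inner_add_left, inner_sub_left,
      real_inner_smul_left, real_inner_smul_left, inner_neg_left,
      LinearMap.adjoint_inner_left, map_sub]
    ring
  have h4 : (2 * δ)⁻¹ = δ⁻¹ / 2 := by field_simp
  have h5 := mul_le_mul_of_nonneg_left hQ hθ
  have h6 := mul_le_mul_of_nonneg_left h2 (by positivity : 0 ≤ δ⁻¹ / 2)
  rw [h3] at hG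
  rw [h1, h4] at hθQ
  rw [h4]
  linarith

lemma tendsto_norm_sub_succ_zero {E : Type*} [NormedAddCommGroup E] {x : ℕ → E}
    {θ Q : ℕ → ℝ} {c M : ℝ} (hc : 0 < c) (hθ : ∀ k, 0 ≤ θ k)
    (hQ0 : ∀ k, 0 < Q k) (hQM : ∀ k, Q k ≤ M)
    (hdec : ∀ k, θ (k+1) * Q (k+1) + c * ‖x (k+1) - x k‖ ^ 2 ≤ θ k * Q (k+1)) :
    Antitone θ ∧ Tendsto (fun k => ‖x (k+1) - x k‖) atTop (𝓝 0) := by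
  have hanti : Antitone θ := antitone_nat_of_succ_le fun k => by
    have h1 : 0 ≤ c * ‖x (k+1) - x k‖ ^ 2 := by positivity
    exact le_of_mul_le_mul_right (by linarith [hdec k]) (hQ0 (k+1))
  refine ⟨hanti, ?_⟩
  have hlim := tendsto_atTop_ciInf hanti ⟨0, by rintro _ ⟨k, rfl⟩; exact hθ k⟩
  have hdiff : Tendsto (fun k => M / c * (θ k - θ (k+1))) atTop (𝓝 0) := by
    simpa using (hlim.sub (hlim.comp (tendsto_add_atTop_nat 1))).const_mul (M / c)
  have hsq : Tendsto (fun k => ‖x (k+1) - x k‖ ^ 2) atTop (𝓝 0) := by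
    refine squeeze_zero (fun _ => sq_nonneg _) (fun k => ?_) hdiff
    rw [div_mul_eq_mul_div, le_div_iff₀ hc]
    have h1 := mul_le_mul_of_nonneg_left (hQM (k+1)) (sub_nonneg.mpr (hanti k.le_succ))
    linarith [hdec k]
  simpa [Real.sqrt_sq] using hsq.sqrt

lemma abs_ratio_sub_le {θ Q P P' D m κ A r : ℝ} (hm : 0 < m) (hD : m / 2 ≤ D) (hθ : 0 ≤ θ)
    (hθQ : θ * Q = P) (hDQ : |D - Q| ≤ κ * r) (hPP : |P' - P| ≤ A * r) :
    |θ - P' / D| ≤ 2 / m * (A + θ * κ) * r := by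
  have hD0 : 0 < D := by linarith
  have e : θ - P' / D = (θ * (D - Q) - (P' - P)) / D := by
    rw [← hθQ]; field_simp; ring
  have h1 : |θ * (D - Q) - (P' - P)| ≤ (A + θ * κ) * r := by
    refine (abs_sub _ _).trans ?_
    rw [abs_mul, abs_of_nonneg hθ]
    have := mul_le_mul_of_nonneg_left hDQ hθ
    linarith
  rw [e, abs_div, abs_of_pos hD0, div_le_iff₀ hD0]
  have h2 : 0 ≤ (A + θ * κ) * r := (abs_nonneg _).trans h1
  refine h1.trans ?_
  have h3 : 2 / m * (A + θ * κ) * r * (m / 2) = (A + θ * κ) * r := by field_simp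
  rw [← h3]
  refine mul_le_mul_of_nonneg_left hD ?_
  rw [mul_assoc]; positivity

lemma abs_sq_norm_sub_le {E : Type*} [NormedAddCommGroup E] {a b : E} {Q r : ℝ}
    (ha : ‖a‖ ≤ Q) (hb : ‖b‖ ≤ Q) (hab : ‖a - b‖ ≤ r) :
    |‖a‖ ^ 2 - ‖b‖ ^ 2| ≤ 2 * Q * r := by
  have e : ‖a‖ ^ 2 - ‖b‖ ^ 2 = (‖a‖ + ‖b‖) * (‖a‖ - ‖b‖) := by ring
  rw [e, abs_mul, abs_of_nonneg (by positivity)]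
  exact mul_le_mul (by linarith) ((abs_norm_sub_norm_le a b).trans hab) (abs_nonneg _)
    (by linarith [norm_nonneg a])

lemma fractional_gradient_eq {E : Type*} [AddCommGroup E] [Module ℝ E] {u u' x' v v' k : E}
    {D P θ δ : ℝ} :
    D⁻¹ • ((δ⁻¹ • (u - x') - v + θ • k) + v' + δ⁻¹ • (x' - u')) - (P / D ^ 2) • k =
      D⁻¹ • (δ⁻¹ • (u - u') + (v' - v) + (θ - P / D) • k) := by
  have e : P / D ^ 2 = D⁻¹ * (P / D) := by rw [sq, ← div_div]; ring
  rw [e]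
  module

lemma norm_relaxation_sub_le {E : Type*} [NormedAddCommGroup E] [NormedSpace ℝ E] {u u' x' : E}
    {σ : ℝ} (hσ : 0 < σ) (hσ2 : σ < 2) (hu : u' = (1 - σ) • u + σ • x') :
    ‖u' - x'‖ ≤ σ⁻¹ * ‖u - u'‖ := by
  have e : u' - x' = (σ⁻¹ * (1 - σ)) • (u - u') := by
    rw [hu]
    match_scalars <;> field_simp <;> ring
  have h1 : |1 - σ| ≤ 1 := by rw [abs_le]; constructor <;> linarith
  rw [e, norm_smul, norm_mul, Real.norm_of_nonneg (by positivity : 0 ≤ σ⁻¹), mul_assoc,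
    Real.norm_eq_abs]
  exact mul_le_mul_of_nonneg_left (mul_le_of_le_one_left (norm_nonneg _) h1) (by positivity)

set_option maxHeartbeats 1000000 in
theorem stmt15 {n p : ℕ}
    (S : Set (EuclideanSpace ℝ (Fin n)))
    (g : EuclideanSpace ℝ (Fin n) → EReal)
    (h : EuclideanSpace ℝ (Fin n) → ℝ)
    (gh : EuclideanSpace ℝ (Fin n) → EuclideanSpace ℝ (Fin n))
    (f : EuclideanSpace ℝ (Fin p) → EReal)
    (K : EuclideanSpace ℝ (Fin n) →ₗ[ℝ] EuclideanSpace ℝ (Fin p))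
    (L δ : ℝ)
    (hS : S.Nonempty) (hSconv : Convex ℝ S) (hScomp : IsCompact S)
    (hgP : ERealProper g) (hgconv : ERealConvex g) (hglsc : LowerSemicontinuous g)
    (hfP : ERealProper f) (hfconv : ERealConvex f) (hflsc : LowerSemicontinuous f)
    (hL : 0 < L)
    (hhC1 : ∃ O : Set (EuclideanSpace ℝ (Fin n)), IsOpen O ∧ S ⊆ O ∧
      (∀ z ∈ O, HasGradientAt h (gh z) z) ∧
      (∀ z ∈ O, ∀ w ∈ O, ‖gh z - gh w‖ ≤ L * ‖z - w‖))
    (hKS : ∀ z ∈ S, K z ∈ interior (edom f))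
    (hfpos : ∀ z ∈ S, (0 : EReal) < f (K z))
    (hghnn : ∀ z ∈ S, (0 : EReal) ≤ g z + ((h z : ℝ) : EReal))
    (hSg : ∃ z ∈ S, g z ≠ ⊤)
    (hδ : 0 < δ) (hδL : δ < 1 / L)
    (σ : ℝ) (hσ : 0 < σ) (hσ2 : σ < 2)
    (x u : ℕ → EuclideanSpace ℝ (Fin n)) (y : ℕ → EuclideanSpace ℝ (Fin p)) (θ : ℕ → ℝ)
    (hxS : ∀ k, x k ∈ S ∧ g (x k) ≠ ⊤)
    (hy : ∀ k, y (k+1) ∈ csubdiff f (K (x k)))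
    (hxmin : ∀ k, ∀ w ∈ S,
      g (x (k+1)) + (((2*δ)⁻¹ * ‖x (k+1) - u k + δ • gh (x k)
          - (θ k * δ) • (LinearMap.adjoint K) (y (k+1))‖ ^ 2 : ℝ) : EReal)
        ≤ g w + (((2*δ)⁻¹ * ‖w - u k + δ • gh (x k)
          - (θ k * δ) • (LinearMap.adjoint K) (y (k+1))‖ ^ 2 : ℝ) : EReal))
    (hu : ∀ k, u (k+1) = (1 - σ) • u k + σ • x (k+1))
    (hθ : ∀ k, (θ k : EReal) = varthetaF S g h f K δ (x k) (u k))
    (hθnn : ∀ k, 0 ≤ θ k)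
    (hA2 : (intrinsicInterior ℝ S ∩ intrinsicInterior ℝ (edom g)).Nonempty ∨
      (IsPolyhedral S ∧ (S ∩ intrinsicInterior ℝ (edom g)).Nonempty))
    (m M : ℝ) (hm : 0 < m)
    (hmM : ∀ k, (m : EReal) ≤ f (K (x k)) ∧ f (K (x k)) ≤ (M : EReal))
    (hcalm : ∃ N₀ : ℕ, ∀ k ≥ N₀, ECalm (econj f) (y k))
    :
    ∃ ζ > (0:ℝ), ∃ N : ℕ, ∀ k ≥ N,
      Metric.infDist
        (0 : EuclideanSpace ℝ (Fin n) × EuclideanSpace ℝ (Fin p) × EuclideanSpace ℝ (Fin n))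
        (lsub3 (fun a b c => varpiF S g h f K δ a b c) (x (k+1)) (y (k+1)) (u (k+1)))
      ≤ ζ * (‖x k - x (k+1)‖ + ‖u k - u (k+1)‖) := by
  obtain ⟨O, -, hSO, hgradO, hlipO⟩ := hhC1
  have hgrad : ∀ z ∈ S, HasGradientAt h (gh z) z := fun z hz => hgradO z (hSO hz)
  have hlip : ∀ z ∈ S, ∀ w ∈ S, ‖gh z - gh w‖ ≤ L * ‖z - w‖ :=
    fun z hz w hw => hlipO z (hSO hz) w (hSO hw)
  have hbot := hgP.1
  have hxmem : ∀ k, x k ∈ S := fun k => (hxS k).1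
  set G : ℕ → ℝ := fun k => (g (x k)).toReal with hG
  set Q : ℕ → ℝ := fun k => (f (K (x k))).toReal with hQ
  have hfQ : ∀ k, f (K (x k)) = (Q k : EReal) := fun k =>
    (EReal.coe_toReal (interior_subset (hKS _ (hxmem k)) : K (x k) ∈ edom f)
      (hfP.1 _)).symm
  have hmQ : ∀ k, m ≤ Q k := fun k => by
    have := (hmM k).1; rw [hfQ] at this; exact_mod_cast this
  have hQM : ∀ k, Q k ≤ M := fun k => by
    have := (hmM k).2; rw [hfQ] at this; exact_mod_cast this
  have hQ0 : ∀ k, 0 < Q k := fun k => hm.trans_le (hmQ k)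
  have hM : 0 < M := (hQ0 0).trans_le (hQM 0)
  set P : ℕ → ℝ := fun k => G k + h (x k) + (2 * δ)⁻¹ * ‖x k - u k‖ ^ 2 with hP
  have hθQ : ∀ k, θ k * Q k = P k := fun k => by
    have h1 := hθ k
    rw [varthetaF, phiF_eq_coe (u k) (hxmem k) (hxS k).2 (hbot _), hfQ, ← EReal.coe_div,
      EReal.coe_eq_coe_iff] at h1
    rw [h1, div_mul_cancel₀ _ (hQ0 k).ne']
  have hGh : ∀ k, 0 ≤ G k + h (x k) := fun k => by
    have h1 := hghnn _ (hxmem k)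
    rw [← EReal.coe_toReal (hxS k).2 (hbot _)] at h1
    exact_mod_cast h1
  set ξ : ℕ → EuclideanSpace ℝ (Fin n) := fun k =>
    δ⁻¹ • (u k - x (k+1)) - gh (x k) + θ k • LinearMap.adjoint K (y (k+1)) with hξ
  have hsub : ∀ k, ∀ w ∈ S, g w ≠ ⊤ → G (k+1) + ⟪ξ k, w - x (k+1)⟫ ≤ (g w).toReal := by
    intro k w hw hgw
    have h1 := subgradient_of_prox hSconv hbot hgconv hδ
      (c := u k - δ • gh (x k) + (θ k * δ) • LinearMap.adjoint K (y (k+1)))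
      (hxmem (k+1)) (hxS (k+1)).2 (fun w hw => ?_) hw hgw
    · convert h1 using 3
      rw [hξ]
      match_scalars <;> field_simp
    · have h2 := hxmin k w hw
      have e : ∀ z, z - u k + δ • gh (x k) - (θ k * δ) • LinearMap.adjoint K (y (k+1)) =
        z - (u k - δ • gh (x k) + (θ k * δ) • LinearMap.adjoint K (y (k+1))) :=
        fun z => by abel
      rwa [e, e] at h2
  have hQsub : ∀ k, Q k + ⟪y (k+1), K (x (k+1)) - K (x k)⟫ ≤ Q (k+1) := fun k => by
    have h1 := hy k (K (x (k+1)))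
    rw [hfQ, hfQ] at h1
    exact_mod_cast h1
  have hc : 0 < (2 * δ)⁻¹ - L / 2 := by
    have h1 : L < δ⁻¹ := by
      rw [lt_inv_comm₀ hL hδ, ← one_div]; exact hδL
    have h2 : (2 * δ)⁻¹ = δ⁻¹ / 2 := by field_simp
    linarith
  obtain ⟨hanti, hlim⟩ := tendsto_norm_sub_succ_zero (x := x) hc hθnn hQ0 hQM fun k => by
    rw [hθQ (k+1)]
    exact step_decrease hδ hσ hσ2 (hθnn k) (hsub k _ (hxmem k) (hxS k).2)
      (le_quadratic_of_lipschitz_gradient hSconv hgrad hlip (hxmem k) (hxmem (k+1)))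
      (hQsub k) (hu k) (hθQ k)
  have hθ0 : ∀ k, θ k ≤ θ 0 := fun k => hanti k.zero_le
  have hP0 : ∀ k, 0 ≤ P k := fun k => by rw [← hθQ]; exact mul_nonneg (hθnn k) (hQ0 k).le
  have hPM : ∀ k, P k ≤ θ 0 * M := fun k => by
    rw [← hθQ]; exact mul_le_mul (hθ0 k) (hQM k) (hQ0 k).le (hθnn 0)
  obtain ⟨κ, hκ0, hκ⟩ : ∃ κ, 0 ≤ κ ∧ ∀ z, ‖K z‖ ≤ κ * ‖z‖ :=
    ⟨‖LinearMap.toContinuousLinearMap K‖, norm_nonneg _,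
      fun z => (LinearMap.toContinuousLinearMap K).le_opNorm z⟩
  obtain ⟨Y, hY0, hY⟩ := exists_bound_csubdiff hfP.1 hfconv
    (hScomp.image K.continuous_of_finiteDimensional)
    (image_subset_iff.mpr hKS) (forall_mem_image.mpr hfpos)
  have hyY : ∀ k, ‖y (k+1)‖ ≤ Y := fun k => hY _ (mem_image_of_mem K (hxmem k)) _ (hy k)
  obtain ⟨Z, hZ0, hZ⟩ : ∃ Z, 0 ≤ Z ∧ ∀ k, ‖LinearMap.adjoint K (y (k+1))‖ ≤ Z :=
    ⟨‖LinearMap.toContinuousLinearMap (LinearMap.adjoint K)‖ * Y, by positivity, fun k =>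
      ((LinearMap.toContinuousLinearMap (LinearMap.adjoint K)).le_opNorm _).trans
        (mul_le_mul_of_nonneg_left (hyY k) (norm_nonneg _))⟩
  obtain ⟨R, hR0, hR⟩ : ∃ R, 0 ≤ R ∧ ∀ z ∈ S, ∀ w ∈ S, ‖z - w‖ ≤ R :=
    ⟨Metric.diam S, Metric.diam_nonneg, fun z hz w hw => by
      rw [← dist_eq_norm]; exact Metric.dist_le_diam_of_mem hScomp.isBounded hz hw⟩
  obtain ⟨B, hB0, hB⟩ : ∃ B, 0 ≤ B ∧ ∀ z ∈ S, ‖gh z‖ ≤ B := by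
    refine ⟨‖gh (x 0)‖ + L * R, by positivity, fun z hz => ?_⟩
    have h1 := (hlip z hz _ (hxmem 0)).trans (mul_le_mul_of_nonneg_left (hR z hz _ (hxmem 0)) hL.le)
    have h2 := norm_le_norm_add_norm_sub' (gh z) (gh (x 0))
    linarith
  obtain ⟨V, hV0, hV⟩ : ∃ V, 0 ≤ V ∧ ∀ k, ‖x k - u k‖ ≤ V := by
    refine ⟨√(2 * δ * (θ 0 * M)), Real.sqrt_nonneg _, fun k => Real.le_sqrt_of_sq_le ?_⟩
    have h1 : (2 * δ)⁻¹ * ‖x k - u k‖ ^ 2 ≤ θ 0 * M := by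
      have h2 : P k = G k + h (x k) + (2 * δ)⁻¹ * ‖x k - u k‖ ^ 2 := rfl
      linarith [hPM k, hGh k]
    rwa [inv_mul_le_iff₀ (by positivity)] at h1
  obtain ⟨Ξ, hΞ0, hΞ⟩ : ∃ Ξ, 0 ≤ Ξ ∧ ∀ k, ‖ξ k‖ ≤ Ξ := by
    refine ⟨δ⁻¹ * (V + R) + B + θ 0 * Z, by have := hθnn 0; positivity, fun k => ?_⟩
    refine (norm_add_le _ _).trans (add_le_add ((norm_sub_le _ _).trans (add_le_add ?_
      (hB _ (hxmem k)))) ?_)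
    · rw [norm_smul, Real.norm_of_nonneg (by positivity)]
      refine mul_le_mul_of_nonneg_left ?_ (by positivity)
      have h1 := norm_sub_le_norm_sub_add_norm_sub (u k) (x k) (x (k+1))
      rw [norm_sub_rev (u k) (x k)] at h1
      linarith [hV k, hR _ (hxmem k) _ (hxmem (k+1))]
    · rw [norm_smul, Real.norm_of_nonneg (hθnn k)]
      exact mul_le_mul (hθ0 k) (hZ k) (norm_nonneg _) (hθnn 0)
  have hhlip : ∀ z ∈ S, ∀ w ∈ S, h w - h z ≤ (B + L * R) * ‖w - z‖ := by
    intro z hz w hw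
    have h1 := le_quadratic_of_lipschitz_gradient hSconv hgrad hlip hz hw
    have h2 := (real_inner_le_norm (gh z) (w - z)).trans
      (mul_le_mul_of_nonneg_right (hB z hz) (norm_nonneg _))
    have h3 := mul_le_mul_of_nonneg_right (hR w hw z hz)
      (mul_nonneg hL.le (norm_nonneg (w - z)))
    have h4 : 0 ≤ L * ‖w - z‖ ^ 2 := by positivity
    nlinarith
  have hPlip : ∀ k, |P (k+2) - P (k+1)| ≤ (Ξ + (B + L * R) + δ⁻¹ * V) *
      (‖x (k+1) - x (k+2)‖ + ‖u (k+1) - u (k+2)‖) := by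
    intro k
    have hdx := norm_nonneg (x (k+1) - x (k+2))
    have hdu := norm_nonneg (u (k+1) - u (k+2))
    set dx := ‖x (k+1) - x (k+2)‖ with hdx'
    set du := ‖u (k+1) - u (k+2)‖ with hdu'
    have hrev : ‖x (k+2) - x (k+1)‖ = dx := norm_sub_rev _ _
    have a₁ : |G (k+2) - G (k+1)| ≤ Ξ * dx := by
      have b₁ := hsub (k+1) _ (hxmem (k+1)) (hxS (k+1)).2
      have b₂ := hsub k _ (hxmem (k+2)) (hxS (k+2)).2
      have b₃ := (abs_real_inner_le_norm (ξ (k+1)) (x (k+1) - x (k+2))).trans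
        (mul_le_mul_of_nonneg_right (hΞ (k+1)) hdx)
      have b₄ := (abs_real_inner_le_norm (ξ k) (x (k+2) - x (k+1))).trans
        (mul_le_mul_of_nonneg_right (hΞ k) (norm_nonneg _))
      rw [hrev] at b₄
      rw [abs_le] at b₃ b₄ ⊢
      change G (k+2) + ⟪ξ (k+1), x (k+1) - x (k+2)⟫ ≤ G (k+1) at b₁
      change G (k+1) + ⟪ξ k, x (k+2) - x (k+1)⟫ ≤ G (k+2) at b₂
      constructor <;> linarith
    have a₂ : |h (x (k+2)) - h (x (k+1))| ≤ (B + L * R) * dx := by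
      have b₁ := hhlip _ (hxmem (k+1)) _ (hxmem (k+2))
      have b₂ := hhlip _ (hxmem (k+2)) _ (hxmem (k+1))
      rw [hrev] at b₁
      rw [abs_le]
      constructor <;> linarith
    have a₃ : |‖x (k+2) - u (k+2)‖ ^ 2 - ‖x (k+1) - u (k+1)‖ ^ 2| ≤ 2 * V * (dx + du) := by
      refine abs_sq_norm_sub_le (hV _) (hV _) ?_
      have e : x (k+2) - u (k+2) - (x (k+1) - u (k+1)) =
        (u (k+1) - u (k+2)) - (x (k+1) - x (k+2)) := by abel
      rw [e]
      linarith [norm_sub_le (u (k+1) - u (k+2)) (x (k+1) - x (k+2))]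
    have e : P (k+2) - P (k+1) = (G (k+2) - G (k+1)) + (h (x (k+2)) - h (x (k+1))) +
        (2 * δ)⁻¹ * (‖x (k+2) - u (k+2)‖ ^ 2 - ‖x (k+1) - u (k+1)‖ ^ 2) := by
      simp only [hP]; ring
    have a₄ : |(2 * δ)⁻¹ * (‖x (k+2) - u (k+2)‖ ^ 2 - ‖x (k+1) - u (k+1)‖ ^ 2)| ≤
        δ⁻¹ * V * (dx + du) := by
      rw [abs_mul, abs_of_pos (by positivity : 0 < (2 * δ)⁻¹)]
      refine (mul_le_mul_of_nonneg_left a₃ (by positivity)).trans_eq ?_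
      field_simp
    rw [e]
    refine (abs_add_three _ _ _).trans ?_
    have : 0 ≤ (Ξ + (B + L * R)) * du := by positivity
    linarith
  obtain ⟨N₀, hN₀⟩ := hcalm
  obtain ⟨N₁, hN₁⟩ := eventually_atTop.mp
    ((show Tendsto (fun k => κ * Y * ‖x (k+1) - x k‖) atTop (𝓝 0) by
      simpa using hlim.const_mul (κ * Y)).eventually_lt_const (half_pos hm))
  set A := Ξ + (B + L * R) + δ⁻¹ * V with hA
  have hA0 : 0 ≤ A := by positivity
  have hθ00 := hθnn 0
  set c₁ := 2 / m * (δ⁻¹ + L + 2 / m * (A + θ 0 * (κ * Y)) * Z) with hc₁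
  set c₂ := θ 0 * M * (2 / m) ^ 2 * κ with hc₂
  set c₃ := 2 / m * δ⁻¹ * σ⁻¹ with hc₃
  refine ⟨c₁ + c₂ + c₃, by positivity, max (max N₀ N₁) 1, fun k hk => ?_⟩
  have hkN₀ : N₀ ≤ k := (le_max_left _ _).trans ((le_max_left _ _).trans hk)
  have hkN₁ : N₁ ≤ k := (le_max_right _ _).trans ((le_max_left _ _).trans hk)
  obtain ⟨j, rfl⟩ : ∃ j, k = j + 1 := ⟨k - 1, by have := (le_max_right _ _).trans hk; omega⟩
  obtain ⟨e, he, hec, hey, hes⟩ := econj_locally_real (hfQ (j+1)) (hy (j+1))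
    (hN₀ (j+1+1) (by omega))
  set D := ⟪K (x (j+1+1)), y (j+1+1)⟫ - e (y (j+1+1)) with hD
  set r := ‖x (j+1) - x (j+1+1)‖ + ‖u (j+1) - u (j+1+1)‖ with hr
  have hdx := norm_nonneg (x (j+1) - x (j+1+1))
  have hdu := norm_nonneg (u (j+1) - u (j+1+1))
  have hr0 : 0 ≤ r := by positivity
  have hDQ' : |D - Q (j+1)| ≤ κ * Y * ‖x (j+1+1) - x (j+1)‖ := by
    have e₁ : D - Q (j+1) = ⟪K (x (j+1+1) - x (j+1)), y (j+1+1)⟫ := by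
      rw [hD, hey, map_sub, inner_sub_left]; ring
    rw [e₁]
    refine (abs_real_inner_le_norm _ _).trans ((mul_le_mul (hκ _) (hyY (j+1))
      (norm_nonneg _) (by positivity)).trans_eq (by ring))
  have hDm : m / 2 ≤ D := by
    have h1 := hN₁ (j+1) hkN₁
    have h2 := (abs_le.mp hDQ').1
    linarith [hmQ (j+1)]
  have hD0 : 0 < D := by linarith
  have hDinv : D⁻¹ ≤ 2 / m := by
    rw [← inv_div]; exact inv_anti₀ (by positivity) hDm
  have hDQ : |D - Q (j+1)| ≤ κ * Y * r := hDQ'.trans <| by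
    rw [norm_sub_rev]
    exact mul_le_mul_of_nonneg_left (by linarith) (by positivity)
  have hmem := mem_fsub3_varpiF (f := f) (K := K) hδ hbot (hxmem (j+1+1)) (hxS (j+1+1)).2
    (hgrad _ (hxmem (j+1+1))) (hsub (j+1)) he hec hes (u := u (j+1+1)) rfl (hP0 (j+1+1)) hD hD0
  refine (infDist_lsub3_le_norm hmem).trans ?_
  change ‖(D⁻¹ • (ξ (j+1) + gh (x (j+1+1)) + δ⁻¹ • (x (j+1+1) - u (j+1+1))) -
    (P (j+1+1) / D ^ 2) • LinearMap.adjoint K (y (j+1+1)),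
      (P (j+1+1) / D ^ 2) • (K (x (j+1)) - K (x (j+1+1))),
      (D⁻¹ * δ⁻¹) • (u (j+1+1) - x (j+1+1)))‖ ≤ _
  have hratio : |θ (j+1) - P (j+1+1) / D| ≤ 2 / m * (A + θ 0 * (κ * Y)) * r := by
    refine (abs_ratio_sub_le hm hDm (hθnn (j+1)) (hθQ (j+1)) hDQ (hPlip j)).trans ?_
    have := hθ0 (j+1)
    gcongr
  have hv₁ : ‖D⁻¹ • (ξ (j+1) + gh (x (j+1+1)) + δ⁻¹ • (x (j+1+1) - u (j+1+1))) -
      (P (j+1+1) / D ^ 2) • LinearMap.adjoint K (y (j+1+1))‖ ≤ c₁ * r := by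
    rw [fractional_gradient_eq, norm_smul, Real.norm_of_nonneg (by positivity), hc₁, mul_assoc]
    refine mul_le_mul hDinv ?_ (norm_nonneg _) (by positivity)
    refine (norm_add₃_le).trans ?_
    rw [norm_smul, norm_smul, Real.norm_of_nonneg (by positivity : 0 ≤ δ⁻¹), Real.norm_eq_abs]
    have b₁ : δ⁻¹ * ‖u (j+1) - u (j+1+1)‖ ≤ δ⁻¹ * r :=
      mul_le_mul_of_nonneg_left (by linarith) (by positivity)
    have b₂ : ‖gh (x (j+1+1)) - gh (x (j+1))‖ ≤ L * r := by
      refine (hlip _ (hxmem _) _ (hxmem _)).trans (mul_le_mul_of_nonneg_left ?_ hL.le)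
      rw [norm_sub_rev]; linarith
    have b₃ := mul_le_mul hratio (hZ (j+1)) (norm_nonneg _) ((abs_nonneg _).trans hratio)
    linarith
  have hv₂ : ‖(P (j+1+1) / D ^ 2) • (K (x (j+1)) - K (x (j+1+1)))‖ ≤ c₂ * r := by
    have b₁ : P (j+1+1) / D ^ 2 ≤ θ 0 * M * (2 / m) ^ 2 := by
      rw [div_eq_mul_inv, ← inv_pow]
      have := hPM (j+1+1)
      gcongr
    have b₂ : ‖K (x (j+1)) - K (x (j+1+1))‖ ≤ κ * r := by
      rw [← map_sub]
      exact (hκ _).trans (mul_le_mul_of_nonneg_left (by linarith) hκ0)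
    rw [norm_smul, Real.norm_of_nonneg (div_nonneg (hP0 _) (by positivity)), hc₂, mul_assoc _ κ]
    exact mul_le_mul b₁ b₂ (norm_nonneg _) (by positivity)
  have hv₃ : ‖(D⁻¹ * δ⁻¹) • (u (j+1+1) - x (j+1+1))‖ ≤ c₃ * r := by
    have b₂ : ‖u (j+1+1) - x (j+1+1)‖ ≤ σ⁻¹ * r :=
      (norm_relaxation_sub_le hσ hσ2 (hu (j+1))).trans
        (mul_le_mul_of_nonneg_left (by linarith) (by positivity))
    rw [norm_smul, Real.norm_of_nonneg (by positivity), hc₃, mul_assoc _ σ⁻¹]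
    refine mul_le_mul ?_ b₂ (norm_nonneg _) (by positivity)
    exact mul_le_mul_of_nonneg_right hDinv (by positivity)
  have d₁ : 0 ≤ c₁ * r := by positivity
  have d₂ : 0 ≤ c₂ * r := by positivity
  have d₃ : 0 ≤ c₃ * r := by positivity
  refine norm_prod_le_iff.mpr ⟨?_, norm_prod_le_iff.mpr ⟨?_, ?_⟩⟩ <;> dsimp only <;> linarith
end
end

section
/- (Theorem 4.2) Let the sequences (xᵏ, yᵏ, uᵏ, θ_k) be generated by the FPSA iteration, assume ri(S) ∩ ri(dom g) ≠ ∅ (or S polyhedral and S ∩ ri(dom g) ≠ ∅), and suppose f is differentiable with Lipschitz continuous gradient over an open set containing K(S). Then there exists ς > 0 such that for all sufficiently large k, dist(0, ∂ϑ(xᵏ⁺¹, uᵏ⁺¹)) ≤ ς(‖xᵏ − xᵏ⁺¹‖ + ‖uᵏ − uᵏ⁺¹‖), where ∂ϑ denotes the limiting subdifferential of ϑ(x,u) = φ(x,u)/f(Kx). -/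
open Filter Metric Set RealInnerProductSpace
open scoped Topology Classical

noncomputable section

theorem exists_norm_le_of_lipschitz_on_bounded {E : Type*} [SeminormedAddCommGroup E]
    {S : Set E} (hS : Bornology.IsBounded S)
    {G : E → E} {L : ℝ} (hL : ∀ z ∈ S, ∀ w ∈ S, ‖G z - G w‖ ≤ L * ‖z - w‖) :
    ∃ B, 0 ≤ B ∧ ∀ z ∈ S, ‖G z‖ ≤ B := by
  obtain rfl | ⟨c, hc⟩ := S.eq_empty_or_nonempty
  · exact ⟨0, le_rfl, by simp⟩
  obtain ⟨R, hR⟩ := hS.exists_norm_le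
  have hR0 : 0 ≤ R := (norm_nonneg c).trans (hR c hc)
  refine ⟨‖G c‖ + |L| * (R + R), by positivity, fun z hz => ?_⟩
  have hzc : L * ‖z - c‖ ≤ |L| * (R + R) := by
    gcongr
    · exact le_abs_self L
    · exact (norm_sub_le z c).trans (add_le_add (hR z hz) (hR c hc))
  have := norm_le_insert' (G z) (G c)
  linarith [hL z hz c hc]

section Gradient

variable {E : Type*} [NormedAddCommGroup E] [InnerProductSpace ℝ E] [CompleteSpace E]

theorem Convex.abs_sub_le_of_hasGradientAt {S : Set E} (hS : Convex ℝ S) {F : E → ℝ} {G : E → E}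
    {B : ℝ} (hF : ∀ z ∈ S, HasGradientAt F (G z) z) (hB : ∀ z ∈ S, ‖G z‖ ≤ B)
    {a b : E} (ha : a ∈ S) (hb : b ∈ S) : |F b - F a| ≤ B * ‖b - a‖ := by
  have := hS.norm_image_sub_le_of_norm_hasFDerivWithin_le (𝕜 := ℝ)
    (fun z hz => (hF z hz).hasFDerivAt.hasFDerivWithinAt)
    (fun z hz => by simpa using hB z hz) ha hb
  simpa [Real.norm_eq_abs] using this

/-- The descent lemma. -/
theorem Convex.le_add_inner_add_sq_of_lipschitz_gradient {S : Set E} (hS : Convex ℝ S)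
    {F : E → ℝ} {G : E → E} {L : ℝ} (hF : ∀ z ∈ S, HasGradientAt F (G z) z)
    (hL : ∀ z ∈ S, ∀ w ∈ S, ‖G z - G w‖ ≤ L * ‖z - w‖) {a b : E} (ha : a ∈ S) (hb : b ∈ S) :
    F b ≤ F a + ⟪G a, b - a⟫ + L / 2 * ‖b - a‖ ^ 2 := by
  have hmem : ∀ t ∈ Icc (0 : ℝ) 1, a + t • (b - a) ∈ S := fun t ht =>
    hS.add_smul_sub_mem ha hb ht
  have hline : ∀ t : ℝ, HasDerivAt (fun t : ℝ => a + t • (b - a)) (b - a) t := fun t => by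
    simpa using ((hasDerivAt_id t).smul_const (b - a)).const_add a
  have hder : ∀ t ∈ Icc (0 : ℝ) 1,
      HasDerivAt (fun t : ℝ => F (a + t • (b - a))) ⟪G (a + t • (b - a)), b - a⟫ t :=
    fun t ht => by
      have := (hF _ (hmem t ht)).hasFDerivAt.comp_hasDerivAt t (hline t)
      exact this
  have hbd : ∀ t : ℝ, HasDerivAt
      (fun t : ℝ => F a + t * ⟪G a, b - a⟫ + L / 2 * ‖b - a‖ ^ 2 * t ^ 2)
      (⟪G a, b - a⟫ + L * ‖b - a‖ ^ 2 * t) t := fun t => by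
    have h1 := ((hasDerivAt_id t).mul_const ⟪G a, b - a⟫).const_add (F a)
    have h2 := ((hasDerivAt_id t).pow 2).const_mul (L / 2 * ‖b - a‖ ^ 2)
    refine (h1.add h2).congr_deriv ?_
    simp
    ring
  have key := image_le_of_deriv_right_le_deriv_boundary
    (fun t ht => (hder t ht).continuousAt.continuousWithinAt)
    (fun t ht => (hder t (Ico_subset_Icc_self ht)).hasDerivWithinAt)
    (by simp) (fun t _ => (hbd t).continuousAt.continuousWithinAt)
    (fun t _ => (hbd t).hasDerivWithinAt)
    (fun t ht => by
      have h1 := hL _ (hmem t (Ico_subset_Icc_self ht)) a ha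
      have h2 := real_inner_le_norm (G (a + t • (b - a)) - G a) (b - a)
      rw [inner_sub_left] at h2
      rw [add_sub_cancel_left, norm_smul, Real.norm_of_nonneg ht.1] at h1
      have h3 := mul_le_mul_of_nonneg_right h1 (norm_nonneg (b - a))
      nlinarith)
    (right_mem_Icc.2 zero_le_one)
  simpa using key

theorem eq_of_mem_csubdiff_of_hasGradientAt {f : E → EReal} {fr : E → ℝ} {a v G : E}
    (hv : v ∈ csubdiff f a) (hfr : ∀ᶠ w in 𝓝 a, f w = ((fr w : ℝ) : EReal))
    (hG : HasGradientAt fr G a) : v = G := by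
  have hmin : IsLocalMin (fun w => fr w - ⟪v, w⟫) a := by
    filter_upwards [hfr] with w hw
    have := hv w
    rw [hw, hfr.self_of_nhds, ← EReal.coe_add, EReal.coe_le_coe_iff, inner_sub_right] at this
    linarith
  have hder : HasFDerivAt (fun w => fr w - ⟪v, w⟫) (InnerProductSpace.toDual ℝ E (G - v)) a := by
    rw [map_sub]
    exact hG.hasFDerivAt.sub (InnerProductSpace.toDual ℝ E v).hasFDerivAt
  have := hmin.hasFDerivAt_eq_zero hder
  rw [map_eq_zero_iff _ (LinearIsometryEquiv.injective _), sub_eq_zero] at this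
  exact this.symm

end Gradient

/-- First-order optimality condition for a proximal step of a convex function over a convex set. -/
theorem ERealConvex.inner_le_of_prox {E : Type*} [NormedAddCommGroup E] [InnerProductSpace ℝ E]
    {S : Set E} (hS : Convex ℝ S) {g : E → EReal} (hg : ERealConvex g) {δ : ℝ}
    {a q z : E} {r s : ℝ} (ha : a ∈ S) (hz : z ∈ S)
    (hga : g a = (r : EReal)) (hgz : g z = (s : EReal))
    (hmin : ∀ w ∈ S, g a + (((2 * δ)⁻¹ * ‖a - q‖ ^ 2 : ℝ) : EReal)
      ≤ g w + (((2 * δ)⁻¹ * ‖w - q‖ ^ 2 : ℝ) : EReal)) :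
    r + ⟪δ⁻¹ • (q - a), z - a⟫ ≤ s := by
  have hstep : ∀ t ∈ Ioo (0 : ℝ) 1,
      r ≤ s + (2 * δ)⁻¹ * (2 * ⟪a - q, z - a⟫ + t * ‖z - a‖ ^ 2) := by
    rintro t ⟨ht0, ht1⟩
    have hc := hg a z (1 - t) t (by linarith) ht0.le (by ring)
    have hm := hmin _ (hS ha hz (by linarith : (0 : ℝ) ≤ 1 - t) ht0.le (by ring))
    have := hm.trans (add_le_add_left hc _)
    rw [hga, hgz] at this
    norm_cast at this
    have hw : (1 - t) • a + t • z - q = (a - q) + t • (z - a) := by module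
    rw [hw, norm_add_sq_real, inner_smul_right, norm_smul, mul_pow, Real.norm_eq_abs, sq_abs]
      at this
    refine le_of_mul_le_mul_left ?_ ht0
    linarith
  have hlim : Tendsto (fun t : ℝ => s + (2 * δ)⁻¹ * (2 * ⟪a - q, z - a⟫ + t * ‖z - a‖ ^ 2))
      (𝓝[>] 0) (𝓝 (s + (2 * δ)⁻¹ * (2 * ⟪a - q, z - a⟫ + 0 * ‖z - a‖ ^ 2))) := by
    refine Tendsto.mono_left (Continuous.tendsto ?_ 0) nhdsWithin_le_nhds
    fun_prop
  have hle := ge_of_tendsto hlim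
    (eventually_of_mem (Ioo_mem_nhdsGT (zero_lt_one' ℝ)) hstep)
  have hin : ⟪δ⁻¹ • (q - a), z - a⟫ = -(δ⁻¹ * ⟪a - q, z - a⟫) := by
    rw [inner_smul_left, ← neg_sub a q, inner_neg_left]
    simp
  rw [hin]
  rw [mul_inv] at hle
  linarith

section Subdifferential

variable {α β : Type*} [NormedAddCommGroup α] [InnerProductSpace ℝ α]
  [NormedAddCommGroup β] [InnerProductSpace ℝ β]

theorem fsub2_subset_lsub2 (Φ : α → β → EReal) (a : α) (b : β) : fsub2 Φ a b ⊆ lsub2 Φ a b :=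
  fun v hv => ⟨fun _ => (a, b), fun _ => v, tendsto_const_nhds, tendsto_const_nhds,
    fun _ => hv, tendsto_const_nhds⟩

/-- The derivative of a differentiable minorant touching at a point is a Fréchet subgradient. -/
theorem mem_fsub2_of_hasFDerivAt_minorant {Φ : α → β → EReal} {Q : α × β → ℝ}
    {Q' : α × β →L[ℝ] ℝ} {a : α} {b : β} {v : α × β} (hQ : HasFDerivAt Q Q' (a, b))
    (hQ' : ∀ d : α × β, Q' d = ⟪v.1, d.1⟫ + ⟪v.2, d.2⟫) (heq : Φ a b = ((Q (a, b) : ℝ) : EReal))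
    (hle : ∀ᶠ w in 𝓝 (a, b), ((Q w : ℝ) : EReal) ≤ Φ w.1 w.2) : v ∈ fsub2 Φ a b := by
  have hbd : ∀ ε > (0 : ℝ), ((-ε : ℝ) : EReal) ≤ Filter.liminf
      (fun w : α × β =>
        (Φ w.1 w.2 - Φ a b - ((⟪v.1, w.1 - a⟫ + ⟪v.2, w.2 - b⟫ : ℝ) : EReal)) *
          (((‖w - (a, b)‖)⁻¹ : ℝ) : EReal)) (𝓝[≠] (a, b)) := by
    intro ε hε
    refine le_liminf_of_le (by isBoundedDefault) ?_
    filter_upwards [nhdsWithin_le_nhds (hQ.isLittleO.def hε), nhdsWithin_le_nhds hle,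
      self_mem_nhdsWithin] with w hw hwle hne
    have hpos : 0 < ‖w - (a, b)‖ := norm_pos_iff.2 (sub_ne_zero.2 hne)
    have hq : Q' (w - (a, b)) = ⟪v.1, w.1 - a⟫ + ⟪v.2, w.2 - b⟫ := hQ' _
    rw [Real.norm_eq_abs, hq] at hw
    have h1 := (abs_le.1 hw).1
    have h2 : -ε ≤ (Q w - Q (a, b) - (⟪v.1, w.1 - a⟫ + ⟪v.2, w.2 - b⟫)) * ‖w - (a, b)‖⁻¹ := by
      rw [← div_eq_mul_inv, le_div_iff₀ hpos]
      linarith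
    refine (EReal.coe_le_coe_iff.2 h2).trans ?_
    rw [EReal.coe_mul, EReal.coe_sub, EReal.coe_sub, heq]
    refine mul_le_mul_of_nonneg_right ?_ (EReal.coe_nonneg.2 (inv_nonneg.2 hpos.le))
    exact EReal.sub_le_sub (EReal.sub_le_sub hwle le_rfl) le_rfl
  refine EReal.ge_of_forall_gt_iff_ge.1 fun c hc => ?_
  have hc' : c < 0 := by exact_mod_cast hc
  simpa using hbd (-c) (by linarith)

end Subdifferential

section Merit

variable {n p : ℕ} {S : Set (EuclideanSpace ℝ (Fin n))} {g : EuclideanSpace ℝ (Fin n) → EReal}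
  {h : EuclideanSpace ℝ (Fin n) → ℝ} {f : EuclideanSpace ℝ (Fin p) → EReal}
  {K : EuclideanSpace ℝ (Fin n) →ₗ[ℝ] EuclideanSpace ℝ (Fin p)} {δ : ℝ}

theorem varthetaF_eq_coe {a b : EuclideanSpace ℝ (Fin n)} {r s : ℝ} (ha : a ∈ S)
    (hg : g a = (r : EReal)) (hf : f (K a) = (s : EReal)) :
    varthetaF S g h f K δ a b = (((r + h a + (2 * δ)⁻¹ * ‖a - b‖ ^ 2) / s : ℝ) : EReal) := by
  rw [varthetaF, phiF, if_pos ha, hg, hf, EReal.coe_div, EReal.coe_add, EReal.coe_add, add_zero]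

theorem varthetaF_eq_top {a b : EuclideanSpace ℝ (Fin n)} {s : ℝ} (hg : g a ≠ ⊥)
    (ha : a ∉ S ∨ g a = ⊤) (hf : f (K a) = (s : EReal)) (hs : 0 < s) :
    varthetaF S g h f K δ a b = ⊤ := by
  have hphi : phiF S g h δ a b = ⊤ := by
    rw [phiF]
    by_cases haS : a ∈ S
    · rw [ha.resolve_left (not_not.2 haS), if_pos haS, EReal.top_add_coe, add_zero,
        EReal.top_add_coe]
    · rw [if_neg haS, EReal.add_top_of_ne_bot, EReal.top_add_coe]
      simp [EReal.add_eq_bot_iff, hg]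
  rw [varthetaF, hphi, hf]
  exact EReal.top_div_of_pos_ne_top (by exact_mod_cast hs) (EReal.coe_ne_top s)

theorem mem_fsub2_varthetaF (hgP : ∀ z, g z ≠ ⊥) {F : EuclideanSpace ℝ (Fin n) → ℝ}
    {a b v gha gFa : EuclideanSpace ℝ (Fin n)} {r θ : ℝ} (ha : a ∈ S) (hga : g a = (r : EReal))
    (hv : ∀ z ∈ S, ∀ s : ℝ, g z = (s : EReal) → r + ⟪v, z - a⟫ ≤ s)
    (hh : HasGradientAt h gha a) (hfF : ∀ᶠ z in 𝓝 a, f (K z) = ((F z : ℝ) : EReal))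
    (hF : HasGradientAt F gFa a) (hFa : 0 < F a)
    (hθ : θ * F a = r + h a + (2 * δ)⁻¹ * ‖a - b‖ ^ 2) :
    ((F a)⁻¹ • (v + gha + δ⁻¹ • (a - b) - θ • gFa), (F a)⁻¹ • (δ⁻¹ • (b - a))) ∈
      fsub2 (fun a b => varthetaF S g h f K δ a b) a b := by
  have hfst : HasFDerivAt (fun w : EuclideanSpace ℝ (Fin n) × EuclideanSpace ℝ (Fin n) => w.1)
    (ContinuousLinearMap.fst ℝ _ _) (a, b) := hasFDerivAt_fst
  have hsnd : HasFDerivAt (fun w : EuclideanSpace ℝ (Fin n) × EuclideanSpace ℝ (Fin n) => w.2)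
    (ContinuousLinearMap.snd ℝ _ _) (a, b) := hasFDerivAt_snd
  have hlin := ((innerSL ℝ v).hasFDerivAt.comp (a, b) (hfst.sub_const a)).const_add r
  have hh' := hh.hasFDerivAt.comp (a, b) hfst
  have hsq := ((hfst.sub hsnd).norm_sq).const_mul (2 * δ)⁻¹
  have hFinv := (hasDerivAt_inv hFa.ne').comp_hasFDerivAt (a, b) (hF.hasFDerivAt.comp (a, b) hfst)
  have hQ := ((hlin.add hh').add hsq).mul hFinv
  refine mem_fsub2_of_hasFDerivAt_minorant hQ ?_ ?_ ?_
  · rintro ⟨d, e⟩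
    have hval : (r + h a) * 2 + ‖a - b‖ ^ 2 / δ = 2 * (θ * F a) := by
      rw [hθ, mul_inv]
      ring
    simp [inner_add_left, inner_sub_left, inner_sub_right, inner_smul_left]
    field_simp
    rw [hval]
    ring
  · simp only [varthetaF_eq_coe ha hga hfF.self_of_nhds]
    simp [div_eq_mul_inv]
  · have hev : ∀ᶠ z in 𝓝 a, f (K z) = ((F z : ℝ) : EReal) ∧ 0 < F z :=
      hfF.and (hF.hasFDerivAt.continuousAt.eventually (lt_mem_nhds hFa))
    filter_upwards [continuousAt_fst.eventually hev] with w hw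
    by_cases htop : w.1 ∉ S ∨ g w.1 = ⊤
    · rw [varthetaF_eq_top (hgP _) htop hw.1 hw.2]
      exact le_top
    · push Not at htop
      have hgw := (EReal.coe_toReal htop.2 (hgP w.1)).symm
      rw [varthetaF_eq_coe htop.1 hgw hw.1, EReal.coe_le_coe_iff, div_eq_mul_inv]
      have := hv _ htop.1 _ hgw
      simp
      gcongr
      exact inv_nonneg.2 hw.2.le

end Merit

theorem abs_norm_sq_sub_norm_sq_le {E : Type*} [SeminormedAddCommGroup E] {D : ℝ} {a b : E}
    (ha : ‖a‖ ≤ D) (hb : ‖b‖ ≤ D) :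
    |‖a‖ ^ 2 - ‖b‖ ^ 2| ≤ 2 * D * ‖a - b‖ := by
  rw [sq_sub_sq, abs_mul, abs_of_nonneg (by positivity)]
  have h1 := abs_norm_sub_norm_le a b
  have h2 : ‖a‖ + ‖b‖ ≤ 2 * D := by linarith
  exact mul_le_mul h2 h1 (abs_nonneg _) (by linarith [norm_nonneg a])

/-- Lipschitz-type estimate for the ratio of the merit function to the denominator. -/
theorem abs_ratio_sub_le_s16 {δ m D Θ Bg Bh BF θ θ' gx gx' hx hx' Fx Fx' : ℝ} {E : Type*}
    [SeminormedAddCommGroup E] {x x' u u' : E}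
    (hδ : 0 < δ) (hm : 0 < m) (hΘ : |θ| ≤ Θ) (hBg : 0 ≤ Bg) (hBh : 0 ≤ Bh) (hBF : 0 ≤ BF)
    (hg : |gx' - gx| ≤ Bg * ‖x' - x‖) (hh : |hx' - hx| ≤ Bh * ‖x' - x‖)
    (hF : |Fx' - Fx| ≤ BF * ‖x' - x‖) (hFm : m ≤ Fx')
    (hD : ‖x - u‖ ≤ D) (hD' : ‖x' - u'‖ ≤ D)
    (hθ : θ * Fx = gx + hx + (2 * δ)⁻¹ * ‖x - u‖ ^ 2)
    (hθ' : θ' * Fx' = gx' + hx' + (2 * δ)⁻¹ * ‖x' - u'‖ ^ 2) :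
    |θ' - θ| ≤ m⁻¹ * (Bg + Bh + Θ * BF + δ⁻¹ * D) * (‖x - x'‖ + ‖u - u'‖) := by
  rw [norm_sub_rev x' x] at hg hh hF
  have hD0 : 0 ≤ D := (norm_nonneg _).trans hD
  have hΘ0 : 0 ≤ Θ := (abs_nonneg _).trans hΘ
  have hq : (2 * δ)⁻¹ * |‖x' - u'‖ ^ 2 - ‖x - u‖ ^ 2| ≤ δ⁻¹ * D * (‖x - x'‖ + ‖u - u'‖) := by
    have h1 := abs_norm_sq_sub_norm_sq_le hD' hD
    have h2 : ‖x' - u' - (x - u)‖ ≤ ‖x - x'‖ + ‖u - u'‖ := by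
      rw [show x' - u' - (x - u) = (u - u') - (x - x') by abel, add_comm]
      exact norm_sub_le _ _
    calc (2 * δ)⁻¹ * |‖x' - u'‖ ^ 2 - ‖x - u‖ ^ 2|
        ≤ (2 * δ)⁻¹ * (2 * D * (‖x - x'‖ + ‖u - u'‖)) := by
          gcongr
          exact h1.trans (by gcongr)
      _ = δ⁻¹ * D * (‖x - x'‖ + ‖u - u'‖) := by
          rw [mul_inv]
          ring
  have hid : (θ' - θ) * Fx' = (gx' - gx) + (hx' - hx)
      + (2 * δ)⁻¹ * (‖x' - u'‖ ^ 2 - ‖x - u‖ ^ 2) - θ * (Fx' - Fx) := by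
    linear_combination hθ' - hθ
  have hmul : |θ' - θ| * Fx' ≤ (Bg + Bh + Θ * BF + δ⁻¹ * D) * (‖x - x'‖ + ‖u - u'‖) := by
    rw [← abs_of_pos (hm.trans_le hFm), ← abs_mul, hid]
    have e1 := abs_sub ((gx' - gx) + (hx' - hx)
      + (2 * δ)⁻¹ * (‖x' - u'‖ ^ 2 - ‖x - u‖ ^ 2)) (θ * (Fx' - Fx))
    have e2 := abs_add_three (gx' - gx) (hx' - hx)
      ((2 * δ)⁻¹ * (‖x' - u'‖ ^ 2 - ‖x - u‖ ^ 2))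
    have e3 : |θ * (Fx' - Fx)| ≤ Θ * (BF * ‖x - x'‖) := by
      rw [abs_mul]
      gcongr
    rw [abs_mul (2 * δ)⁻¹, abs_of_pos (by positivity : 0 < (2 * δ)⁻¹)] at e2
    have e4 : 0 ≤ (Bg + Bh + Θ * BF) * ‖u - u'‖ := by positivity
    linarith
  rw [mul_assoc, inv_mul_eq_div, le_div_iff₀ hm]
  exact (mul_le_mul_of_nonneg_left hFm (abs_nonneg _)).trans hmul

section Iteration

variable {E : Type*} [NormedAddCommGroup E] [InnerProductSpace ℝ E]

/-- A relaxation of a bounded sequence with relaxation parameter in `(0, 2)` is bounded. -/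
theorem exists_norm_le_of_relaxation {σ : ℝ} (hσ : 0 < σ) (hσ2 : σ < 2) {x u : ℕ → E}
    (hx : ∃ R, ∀ k, ‖x k‖ ≤ R) (hu : ∀ k, u (k + 1) = (1 - σ) • u k + σ • x (k + 1)) :
    ∃ U, ∀ k, ‖u k‖ ≤ U := by
  obtain ⟨R, hR⟩ := hx
  have hσ1 : 0 < 1 - |1 - σ| := sub_pos.2 (abs_lt.2 ⟨by linarith, by linarith⟩)
  refine ⟨max ‖u 0‖ (σ * R / (1 - |1 - σ|)), fun k => ?_⟩
  induction k with
  | zero => exact le_max_left _ _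
  | succ k ih =>
    set U := max ‖u 0‖ (σ * R / (1 - |1 - σ|))
    have h1 : σ * R ≤ U * (1 - |1 - σ|) := (div_le_iff₀ hσ1).1 (le_max_right _ _)
    have h2 : ‖u (k + 1)‖ ≤ |1 - σ| * ‖u k‖ + σ * ‖x (k + 1)‖ := by
      rw [hu]
      refine (norm_add_le _ _).trans_eq ?_
      rw [norm_smul, norm_smul, Real.norm_eq_abs, Real.norm_of_nonneg hσ.le]
    have h3 := mul_le_mul_of_nonneg_left ih (abs_nonneg (1 - σ))
    have h4 := mul_le_mul_of_nonneg_left (hR (k + 1)) hσ.le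
    linarith

/-- One proximal-gradient step does not increase the ratio of the merit function to the
denominator. -/
theorem merit_le_mul_of_prox_step {L δ σ θ gx gx' hx hx' Fx Fx' : ℝ} {x x' u u' G H : E}
    (hδ : 0 < δ) (hδL : L * δ ≤ 1) (hσ : 0 < σ) (hσ2 : σ < 2) (hθ0 : 0 ≤ θ)
    (hprox : gx' + ⟪δ⁻¹ • (u - x') - H + θ • G, x - x'⟫ ≤ gx)
    (hh : hx' ≤ hx + ⟪H, x' - x⟫ + L / 2 * ‖x' - x‖ ^ 2)
    (hF : Fx + ⟪G, x' - x⟫ ≤ Fx')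
    (hθ : θ * Fx = gx + hx + (2 * δ)⁻¹ * ‖x - u‖ ^ 2)
    (hu : u' = (1 - σ) • u + σ • x') :
    gx' + hx' + (2 * δ)⁻¹ * ‖x' - u'‖ ^ 2 ≤ θ * Fx' := by
  have hδ2 : 0 < (2 * δ)⁻¹ := by positivity
  have hu' : ‖x' - u'‖ ^ 2 ≤ ‖x' - u‖ ^ 2 := by
    have : x' - u' = (1 - σ) • (x' - u) := by rw [hu]; module
    rw [this, norm_smul, mul_pow, Real.norm_eq_abs, sq_abs]
    exact mul_le_of_le_one_left (sq_nonneg _) (by nlinarith)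
  have hL : L / 2 ≤ (2 * δ)⁻¹ := by
    rw [mul_inv, div_eq_inv_mul]
    gcongr
    rwa [← one_div, le_div_iff₀ hδ]
  have hinner : ⟪δ⁻¹ • (u - x') - H + θ • G, x - x'⟫
      = 2 * (2 * δ)⁻¹ * ⟪u - x', x - x'⟫ + ⟪H, x' - x⟫ - θ * ⟪G, x' - x⟫ := by
    rw [← neg_sub x' x, inner_neg_right, inner_neg_right, inner_add_left, inner_sub_left,
      inner_smul_left, inner_smul_left]
    simp
    ring
  have hpar : ‖x - u‖ ^ 2 = ‖x' - u‖ ^ 2 + ‖x' - x‖ ^ 2 - 2 * ⟪u - x', x - x'⟫ := by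
    have : x - u = (x - x') - (u - x') := by abel
    rw [this, norm_sub_sq_real, real_inner_comm, norm_sub_rev u x', norm_sub_rev x x']
    ring
  rw [hinner] at hprox
  rw [hpar] at hθ
  have h1 := mul_le_mul_of_nonneg_left hF hθ0
  have h2 := mul_le_mul_of_nonneg_right hL (sq_nonneg ‖x' - x‖)
  have h3 := mul_le_mul_of_nonneg_left hu' hδ2.le
  linarith

end Iteration

theorem LinearMap.hasGradientAt_comp {E E' : Type*} [NormedAddCommGroup E]
    [InnerProductSpace ℝ E] [FiniteDimensional ℝ E] [NormedAddCommGroup E']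
    [InnerProductSpace ℝ E'] [FiniteDimensional ℝ E'] (K : E →ₗ[ℝ] E') {F : E' → ℝ} {G : E'}
    {z : E} (hF : HasGradientAt F G (K z)) :
    HasGradientAt (fun w => F (K w)) (LinearMap.adjoint K G) z := by
  rw [hasGradientAt_iff_hasFDerivAt]
  have hK : HasFDerivAt K (LinearMap.toContinuousLinearMap K) z :=
    (LinearMap.toContinuousLinearMap K).hasFDerivAt
  refine (hF.hasFDerivAt.comp z hK).congr_fderiv ?_
  ext w
  simp [LinearMap.adjoint_inner_left]

theorem stmt16 {n p : ℕ}
    (S : Set (EuclideanSpace ℝ (Fin n)))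
    (g : EuclideanSpace ℝ (Fin n) → EReal)
    (h : EuclideanSpace ℝ (Fin n) → ℝ)
    (gh : EuclideanSpace ℝ (Fin n) → EuclideanSpace ℝ (Fin n))
    (f : EuclideanSpace ℝ (Fin p) → EReal)
    (K : EuclideanSpace ℝ (Fin n) →ₗ[ℝ] EuclideanSpace ℝ (Fin p))
    (L δ : ℝ)
    (hS : S.Nonempty) (hSconv : Convex ℝ S) (hScomp : IsCompact S)
    (hgP : ERealProper g) (hgconv : ERealConvex g) (hglsc : LowerSemicontinuous g)
    (hfP : ERealProper f) (hfconv : ERealConvex f) (hflsc : LowerSemicontinuous f)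
    (hL : 0 < L)
    (hhC1 : ∃ O : Set (EuclideanSpace ℝ (Fin n)), IsOpen O ∧ S ⊆ O ∧
      (∀ z ∈ O, HasGradientAt h (gh z) z) ∧
      (∀ z ∈ O, ∀ w ∈ O, ‖gh z - gh w‖ ≤ L * ‖z - w‖))
    (hKS : ∀ z ∈ S, K z ∈ interior (edom f))
    (hfpos : ∀ z ∈ S, (0 : EReal) < f (K z))
    (hghnn : ∀ z ∈ S, (0 : EReal) ≤ g z + ((h z : ℝ) : EReal))
    (hSg : ∃ z ∈ S, g z ≠ ⊤)
    (hδ : 0 < δ) (hδL : δ < 1 / L)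
    (σ : ℝ) (hσ : 0 < σ) (hσ2 : σ < 2)
    (x u : ℕ → EuclideanSpace ℝ (Fin n)) (y : ℕ → EuclideanSpace ℝ (Fin p)) (θ : ℕ → ℝ)
    (hxS : ∀ k, x k ∈ S ∧ g (x k) ≠ ⊤)
    (hy : ∀ k, y (k+1) ∈ csubdiff f (K (x k)))
    (hxmin : ∀ k, ∀ w ∈ S,
      g (x (k+1)) + (((2*δ)⁻¹ * ‖x (k+1) - u k + δ • gh (x k)
          - (θ k * δ) • (LinearMap.adjoint K) (y (k+1))‖ ^ 2 : ℝ) : EReal)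
        ≤ g w + (((2*δ)⁻¹ * ‖w - u k + δ • gh (x k)
          - (θ k * δ) • (LinearMap.adjoint K) (y (k+1))‖ ^ 2 : ℝ) : EReal))
    (hu : ∀ k, u (k+1) = (1 - σ) • u k + σ • x (k+1))
    (hθ : ∀ k, (θ k : EReal) = varthetaF S g h f K δ (x k) (u k))
    (hθnn : ∀ k, 0 ≤ θ k)
    (hA2 : (intrinsicInterior ℝ S ∩ intrinsicInterior ℝ (edom g)).Nonempty ∨
      (IsPolyhedral S ∧ (S ∩ intrinsicInterior ℝ (edom g)).Nonempty))
    (m M : ℝ) (hm : 0 < m)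
    (hmM : ∀ k, (m : EReal) ≤ f (K (x k)) ∧ f (K (x k)) ≤ (M : EReal))
    (fr : EuclideanSpace ℝ (Fin p) → ℝ)
    (gf : EuclideanSpace ℝ (Fin p) → EuclideanSpace ℝ (Fin p))
    (hfC1 : ∃ V : Set (EuclideanSpace ℝ (Fin p)), IsOpen V ∧ (∀ z ∈ S, K z ∈ V) ∧
      (∀ w ∈ V, f w = ((fr w : ℝ) : EReal)) ∧ (∀ w ∈ V, HasGradientAt fr (gf w) w) ∧
      ∃ Lf : ℝ, 0 ≤ Lf ∧ ∀ w ∈ V, ∀ w' ∈ V, ‖gf w - gf w'‖ ≤ Lf * ‖w - w'‖)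
    :
    ∃ ς > (0:ℝ), ∃ N : ℕ, ∀ k ≥ N,
      Metric.infDist
        (0 : EuclideanSpace ℝ (Fin n) × EuclideanSpace ℝ (Fin n))
        (lsub2 (fun a b => varthetaF S g h f K δ a b) (x (k+1)) (u (k+1)))
      ≤ ς * (‖x k - x (k+1)‖ + ‖u k - u (k+1)‖) := by
  obtain ⟨O, -, hSO, hhO, hhL⟩ := hhC1
  obtain ⟨V, hVo, hSV, hfV, hfG, Lf, hLf, hfL⟩ := hfC1
  have hbdd : Bornology.IsBounded S := hScomp.isBounded
  -- Pull the denominator back to the primal space.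
  set F : EuclideanSpace ℝ (Fin n) → ℝ := fun z => fr (K z)
  set G : EuclideanSpace ℝ (Fin n) → EuclideanSpace ℝ (Fin n) :=
    fun z => LinearMap.adjoint K (gf (K z))
  have hFG : ∀ z ∈ S, HasGradientAt F (G z) z := fun z hz =>
    K.hasGradientAt_comp (hfG _ (hSV z hz))
  have hKc : Continuous K := K.continuous_of_finiteDimensional
  have hfF : ∀ z ∈ S, ∀ᶠ w in 𝓝 z, f (K w) = ((F w : ℝ) : EReal) := fun z hz =>
    (hKc.continuousAt.eventually (hVo.mem_nhds (hSV z hz))).mono fun w hw => hfV _ hw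
  obtain ⟨LF, hLF0, hGL⟩ : ∃ LF : ℝ, 0 ≤ LF ∧ ∀ z ∈ S, ∀ w ∈ S, ‖G z - G w‖ ≤ LF * ‖z - w‖ := by
    set A := LinearMap.toContinuousLinearMap (LinearMap.adjoint K)
    set B := LinearMap.toContinuousLinearMap K
    refine ⟨‖A‖ * (Lf * ‖B‖), by positivity, fun z hz w hw => ?_⟩
    calc ‖G z - G w‖ = ‖A (gf (K z) - gf (K w))‖ := by rw [map_sub]; rfl
      _ ≤ ‖A‖ * ‖gf (K z) - gf (K w)‖ := A.le_opNorm _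
      _ ≤ ‖A‖ * (Lf * ‖B (z - w)‖) := by
        gcongr
        rw [map_sub]
        exact hfL _ (hSV z hz) _ (hSV w hw)
      _ ≤ ‖A‖ * (Lf * (‖B‖ * ‖z - w‖)) := by
        gcongr
        exact B.le_opNorm _
      _ = ‖A‖ * (Lf * ‖B‖) * ‖z - w‖ := by ring
  have hhS : ∀ z ∈ S, HasGradientAt h (gh z) z := fun z hz => hhO z (hSO hz)
  have hhLS : ∀ z ∈ S, ∀ w ∈ S, ‖gh z - gh w‖ ≤ L * ‖z - w‖ := fun z hz w hw =>
    hhL z (hSO hz) w (hSO hw)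
  obtain ⟨BF, hBF0, hBF⟩ := exists_norm_le_of_lipschitz_on_bounded hbdd hGL
  obtain ⟨Bh, hBh0, hBh⟩ := exists_norm_le_of_lipschitz_on_bounded hbdd hhLS
  -- Real-valued form of the iteration.
  have hxk : ∀ k, x k ∈ S := fun k => (hxS k).1
  have hgx : ∀ k, g (x k) = (((g (x k)).toReal : ℝ) : EReal) := fun k =>
    (EReal.coe_toReal (hxS k).2 (hgP.1 _)).symm
  set γ : ℕ → ℝ := fun k => (g (x k)).toReal
  have hFm : ∀ k, m ≤ F (x k) := fun k => by
    have := (hmM k).1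
    rwa [hfV _ (hSV _ (hxk k)), EReal.coe_le_coe_iff] at this
  have hFpos : ∀ k, 0 < F (x k) := fun k => hm.trans_le (hFm k)
  have hKy : ∀ k, LinearMap.adjoint K (y (k + 1)) = G (x k) := fun k => by
    rw [eq_of_mem_csubdiff_of_hasGradientAt (hy k)
      (eventually_of_mem (hVo.mem_nhds (hSV _ (hxk k))) hfV)
      (hfG _ (hSV _ (hxk k)))]
  have hθr : ∀ k, θ k * F (x k) = γ k + h (x k) + (2 * δ)⁻¹ * ‖x k - u k‖ ^ 2 := fun k => by
    have := hθ k
    rw [varthetaF_eq_coe (hxk k) (hgx k) (hfV _ (hSV _ (hxk k))), EReal.coe_eq_coe_iff] at this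
    rw [this]
    exact div_mul_cancel₀ _ (hFpos k).ne'
  set v : ℕ → EuclideanSpace ℝ (Fin n) :=
    fun k => δ⁻¹ • (u k - x (k + 1)) - gh (x k) + θ k • G (x k) with hvdef
  have hprox : ∀ k, ∀ z ∈ S, ∀ s : ℝ, g z = (s : EReal) →
      γ (k + 1) + ⟪v k, z - x (k + 1)⟫ ≤ s := fun k z hz s hs => by
    have hq : ∀ w, w - u k + δ • gh (x k) - (θ k * δ) • LinearMap.adjoint K (y (k + 1))
        = w - (u k - δ • gh (x k) + (θ k * δ) • G (x k)) := fun w => by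
      rw [hKy]
      abel
    have hvk : v k = δ⁻¹ • ((u k - δ • gh (x k) + (θ k * δ) • G (x k)) - x (k + 1)) := by
      simp only [hvdef]
      match_scalars <;> field_simp
    rw [hvk]
    refine hgconv.inner_le_of_prox hSconv (hxk (k + 1)) hz (hgx (k + 1)) hs fun w hw => ?_
    have := hxmin k w hw
    rwa [hq, hq] at this
  -- Monotonicity of the ratios and boundedness.
  have hδL1 : L * δ ≤ 1 := by
    have := (lt_div_iff₀ hL).1 hδL
    linarith
  have hdesc : Antitone θ := antitone_nat_of_succ_le fun k => by
    have hFk : F (x k) + ⟪G (x k), x (k + 1) - x k⟫ ≤ F (x (k + 1)) := by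
      have := hy k (K (x (k + 1)))
      rw [hfV _ (hSV _ (hxk k)), hfV _ (hSV _ (hxk (k + 1))), ← EReal.coe_add,
        EReal.coe_le_coe_iff, ← map_sub, ← LinearMap.adjoint_inner_left, hKy] at this
      exact this
    have := merit_le_mul_of_prox_step hδ hδL1 hσ hσ2 (hθnn k) (hprox k _ (hxk k) _ (hgx k))
      (hSconv.le_add_inner_add_sq_of_lipschitz_gradient hhS hhLS (hxk k) (hxk (k + 1)))
      hFk (hθr k) (hu k)
    rw [← hθr (k + 1)] at this
    exact le_of_mul_le_mul_right this (hFpos (k + 1))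
  have hθb : ∀ k, |θ k| ≤ θ 0 := fun k => by
    rw [abs_of_nonneg (hθnn k)]
    exact hdesc (Nat.zero_le k)
  obtain ⟨R, hR⟩ := hbdd.exists_norm_le
  have hRx : ∀ k, ‖x k‖ ≤ R := fun k => hR _ (hxk k)
  obtain ⟨U, hU⟩ := exists_norm_le_of_relaxation hσ hσ2 ⟨R, hRx⟩ hu
  have hD : ∀ j k, ‖x j - u k‖ ≤ R + U := fun j k =>
    (norm_sub_le _ _).trans (add_le_add (hRx j) (hU k))
  have hD0 : 0 ≤ R + U := (norm_nonneg _).trans (hD 0 0)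
  set Bv : ℝ := δ⁻¹ * (R + U) + Bh + θ 0 * BF
  have hBv0 : 0 ≤ Bv := by
    have := hθnn 0
    positivity
  have hBv : ∀ k, ‖v k‖ ≤ Bv := fun k => by
    refine (norm_add_le _ _).trans (add_le_add ((norm_sub_le _ _).trans
      (add_le_add ?_ (hBh _ (hxk k)))) ?_)
    · rw [norm_smul, Real.norm_of_nonneg (inv_nonneg.2 hδ.le), norm_sub_rev]
      gcongr
      exact hD _ _
    · rw [norm_smul, Real.norm_eq_abs]
      exact mul_le_mul (hθb k) (hBF _ (hxk k)) (norm_nonneg _) (hθnn 0)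
  have hγ : ∀ k, 1 ≤ k → |γ (k + 1) - γ k| ≤ Bv * ‖x (k + 1) - x k‖ := fun k hk => by
    obtain ⟨j, rfl⟩ : ∃ j, k = j + 1 := ⟨k - 1, by omega⟩
    have h1 := hprox (j + 1) _ (hxk (j + 1)) _ (hgx (j + 1))
    have h2 := hprox j _ (hxk (j + 1 + 1)) _ (hgx (j + 1 + 1))
    have e1 := (abs_real_inner_le_norm (v (j + 1)) (x (j + 1) - x (j + 1 + 1))).trans
      (mul_le_mul_of_nonneg_right (hBv (j + 1)) (norm_nonneg _))
    have e2 := (abs_real_inner_le_norm (v j) (x (j + 1 + 1) - x (j + 1))).trans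
      (mul_le_mul_of_nonneg_right (hBv j) (norm_nonneg _))
    rw [norm_sub_rev] at e1
    exact abs_le.2 ⟨by linarith [(abs_le.1 e2).1], by linarith [(abs_le.1 e1).1]⟩
  -- The Fréchet subgradient and its norm.
  set C : ℝ := m⁻¹ * (Bv + Bh + θ 0 * BF + δ⁻¹ * (R + U))
  have hC0 : 0 ≤ C := by
    have := hθnn 0
    positivity
  have hθdiff : ∀ k, 1 ≤ k →
      |θ (k + 1) - θ k| ≤ C * (‖x k - x (k + 1)‖ + ‖u k - u (k + 1)‖) := fun k hk =>
    abs_ratio_sub_le_s16 hδ hm (hθb k) hBv0 hBh0 hBF0 (hγ k hk)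
      (hSconv.abs_sub_le_of_hasGradientAt hhS hBh (hxk k) (hxk (k + 1)))
      (hSconv.abs_sub_le_of_hasGradientAt hFG hBF (hxk k) (hxk (k + 1)))
      (hFm (k + 1)) (hD k k) (hD (k + 1) (k + 1)) (hθr k) (hθr (k + 1))
  have hθ0 := hθnn 0
  set C₁ : ℝ := δ⁻¹ + L + C * BF + θ 0 * LF with hC₁def
  set C₂ : ℝ := δ⁻¹ * (|1 - σ| / σ)
  have hC₁ : 0 < C₁ := by positivity
  have hC₂ : 0 ≤ C₂ := by positivity
  refine ⟨m⁻¹ * (C₁ + C₂), by positivity, 1, fun k hk => ?_⟩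
  set Δ : ℝ := ‖x k - x (k + 1)‖ + ‖u k - u (k + 1)‖
  have hΔ0 : 0 ≤ Δ := by positivity
  have hxΔ : ‖x k - x (k + 1)‖ ≤ Δ := le_add_of_nonneg_right (norm_nonneg _)
  have huΔ : ‖u k - u (k + 1)‖ ≤ Δ := le_add_of_nonneg_left (norm_nonneg _)
  have hmem := fsub2_subset_lsub2 _ _ _ (mem_fsub2_varthetaF (h := h) (f := f) (K := K) (δ := δ)
    (b := u (k + 1)) hgP.1 (hxk (k + 1)) (hgx (k + 1)) (hprox k) (hhS _ (hxk (k + 1)))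
    (hfF _ (hxk (k + 1))) (hFG _ (hxk (k + 1))) (hFpos (k + 1)) (hθr (k + 1)))
  have hfst : ‖v k + gh (x (k + 1)) + δ⁻¹ • (x (k + 1) - u (k + 1)) - θ (k + 1) • G (x (k + 1))‖
      ≤ C₁ * Δ := by
    have hsplit : v k + gh (x (k + 1)) + δ⁻¹ • (x (k + 1) - u (k + 1))
        - θ (k + 1) • G (x (k + 1))
        = δ⁻¹ • (u k - u (k + 1)) + (gh (x (k + 1)) - gh (x k))
          - (θ (k + 1) - θ k) • G (x (k + 1)) + θ k • (G (x k) - G (x (k + 1))) := by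
      simp only [hvdef]
      module
    have e1 : ‖δ⁻¹ • (u k - u (k + 1))‖ ≤ δ⁻¹ * Δ := by
      rw [norm_smul, Real.norm_of_nonneg (inv_nonneg.2 hδ.le)]
      gcongr
    have e2 : ‖gh (x (k + 1)) - gh (x k)‖ ≤ L * Δ := by
      refine (hhLS _ (hxk (k + 1)) _ (hxk k)).trans ?_
      rw [norm_sub_rev]
      gcongr
    have e3 : ‖(θ (k + 1) - θ k) • G (x (k + 1))‖ ≤ C * Δ * BF := by
      rw [norm_smul, Real.norm_eq_abs]
      exact mul_le_mul (hθdiff k hk) (hBF _ (hxk (k + 1))) (norm_nonneg _) (by positivity)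
    have e4 : ‖θ k • (G (x k) - G (x (k + 1)))‖ ≤ θ 0 * (LF * Δ) := by
      rw [norm_smul, Real.norm_eq_abs]
      refine mul_le_mul (hθb k) ?_ (norm_nonneg _) hθ0
      exact (hGL _ (hxk k) _ (hxk (k + 1))).trans (by gcongr)
    rw [hsplit]
    refine (norm_add_le_of_le (norm_sub_le_of_le (norm_add_le_of_le e1 e2) e3) e4).trans_eq ?_
    rw [hC₁def]
    ring
  have hsnd : ‖δ⁻¹ • (u (k + 1) - x (k + 1))‖ ≤ C₂ * Δ := by
    have hux : u (k + 1) - x (k + 1) = -((1 - σ) / σ) • (u (k + 1) - u k) := by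
      rw [hu k]
      match_scalars <;> field_simp <;> ring
    rw [hux, norm_smul, norm_smul, Real.norm_of_nonneg (inv_nonneg.2 hδ.le), norm_neg,
      Real.norm_eq_abs, abs_div, abs_of_pos hσ, norm_sub_rev, ← mul_assoc]
    gcongr
  have hinv : ∀ {w : EuclideanSpace ℝ (Fin n)} {c : ℝ}, 0 ≤ c → ‖w‖ ≤ c * Δ →
      ‖(F (x (k + 1)))⁻¹ • w‖ ≤ m⁻¹ * (c * Δ) := fun {w c} hc hw => by
    rw [norm_smul, Real.norm_of_nonneg (inv_nonneg.2 (hFpos (k + 1)).le)]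
    have := hFm (k + 1)
    gcongr
  refine (Metric.infDist_le_dist_of_mem hmem).trans ?_
  rw [dist_zero_left, Prod.norm_def, mul_assoc]
  refine max_le ((hinv hC₁.le hfst).trans ?_) ((hinv hC₂ hsnd).trans ?_)
  · gcongr
    linarith
  · gcongr
    linarith
end
end
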